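/- Let P_1, P_2 ⊂ ℝ^d (d ≥ 2) be combinatorially equivalent polytopes, each inscribed in a sphere and each having all edges of a common length (possibly different for P_1 and P_2). Then P_1 and P_2 are similar: P_2 is obtained from P_1 by a scaling composed with an orthogonal transformation (and translation). -/

import Mathlib

open Set

namespace ISim

section Basic

variable {V : Type*} [AddCommGroup V] [Module ℝ V]

/-- Farkas lemma for finitely many generators. -/
lemma farkas_fin : ∀ (n : ℕ) (Y : Fin n → V) (v : V),
    (∃ c : Fin n → ℝ, (∀ k, 0 ≤ c k) ∧ v = ∑ k, c k • Y k) ∨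
    ∃ l : V →ₗ[ℝ] ℝ, (∀ k, 0 ≤ l (Y k)) ∧ l v < 0 := by
  intro n
  induction n with
  | zero =>
    intro Y v
    by_cases hv : v = 0
    · left; exact ⟨fun _ => 0, fun _ => le_rfl, by simp [hv]⟩
    · right
      have : ¬ ∀ l : Module.Dual ℝ V, l v = 0 := by
        rw [Module.forall_dual_apply_eq_zero_iff]; exact hv
      push Not at this
      obtain ⟨l, hl⟩ := this
      rcases lt_or_gt_of_ne hl with h | h
      · exact ⟨l, fun k => k.elim0, h⟩
      · exact ⟨-l, fun k => k.elim0, by simpa using h⟩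
  | succ n ih =>
    intro Y v
    rcases ih (fun k => Y k.succ) v with ⟨c, hc, h⟩ | ⟨l, hl, hv⟩
    · left
      refine ⟨Fin.cons 0 c, ?_, ?_⟩
      · intro k; refine Fin.cases ?_ ?_ k <;> simp [hc]
      · simp [Fin.sum_univ_succ, h]
    by_cases h0 : 0 ≤ l (Y 0)
    · right
      refine ⟨l, ?_, hv⟩
      intro k; refine Fin.cases h0 hl k
    push Not at h0
    have h0' : l (Y 0) ≠ 0 := h0.ne
    rcases ih (fun k => Y k.succ - (l (Y k.succ) / l (Y 0)) • Y 0) (v - (l v / l (Y 0)) • Y 0) with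
      ⟨c, hc, h⟩ | ⟨m, hm, hmv⟩
    · left
      refine ⟨Fin.cons (l v / l (Y 0) - ∑ k : Fin n, c k * (l (Y k.succ) / l (Y 0))) c, ?_, ?_⟩
      · intro k; refine Fin.cases ?_ ?_ k
        · simp only [Fin.cons_zero]
          have h1 : 0 ≤ l v / l (Y 0) := (div_pos_of_neg_of_neg hv h0).le
          have h2 : ∑ k : Fin n, c k * (l (Y k.succ) / l (Y 0)) ≤ 0 := by
            apply Finset.sum_nonpos
            intro i _
            exact mul_nonpos_of_nonneg_of_nonpos (hc i)
              (div_nonpos_of_nonneg_of_nonpos (hl i) h0.le)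
          linarith
        · simpa using hc
      · rw [sub_eq_iff_eq_add] at h
        conv_lhs => rw [h]
        simp only [Fin.sum_univ_succ, Fin.cons_zero, Fin.cons_succ, smul_sub, sub_smul,
          Finset.sum_sub_distrib, Finset.sum_smul, smul_smul]
        abel
    · right
      refine ⟨m - (m (Y 0) / l (Y 0)) • l, ?_, ?_⟩
      · intro k; refine Fin.cases ?_ ?_ k
        · simp [h0']
        · intro k
          have := hm k
          simp only [map_sub, map_smul, smul_eq_mul] at this
          simp only [LinearMap.sub_apply, LinearMap.smul_apply, smul_eq_mul]
          convert this using 1; ring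
      · simp only [map_sub, map_smul, smul_eq_mul] at hmv
        simp only [LinearMap.sub_apply, LinearMap.smul_apply, smul_eq_mul]
        convert hmv using 1; ring

lemma farkas {ι : Type*} [Fintype ι] (Y : ι → V) (v : V) :
    (∃ c : ι → ℝ, (∀ k, 0 ≤ c k) ∧ v = ∑ k, c k • Y k) ∨
    ∃ l : V →ₗ[ℝ] ℝ, (∀ k, 0 ≤ l (Y k)) ∧ l v < 0 := by
  rcases farkas_fin _ (fun k => Y ((Fintype.equivFin ι).symm k)) v with ⟨c, hc, h⟩ | ⟨l, hl, h⟩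
  · left
    refine ⟨fun i => c (Fintype.equivFin ι i), fun i => hc _, ?_⟩
    rw [h, ← (Fintype.equivFin ι).sum_comp]
    simp
  · right
    exact ⟨l, fun k => by simpa using hl (Fintype.equivFin ι k), h⟩

/-- Farkas modulo a line. -/
lemma farkas_line {ι : Type*} [Fintype ι] (Y : ι → V) (w v : V) :
    (∃ c : ι → ℝ, ∃ t : ℝ, (∀ k, 0 ≤ c k) ∧ v = t • w + ∑ k, c k • Y k) ∨
    ∃ l : V →ₗ[ℝ] ℝ, (∀ k, 0 ≤ l (Y k)) ∧ l w = 0 ∧ l v < 0 := by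
  rcases farkas (ι := Option (Option ι))
    (fun k => k.elim w (fun k => k.elim (-w) Y)) v with ⟨c, hc, h⟩ | ⟨l, hl, h⟩
  · left
    refine ⟨fun i => c (some (some i)), c none - c (some none), fun i => hc _, ?_⟩
    rw [h]
    simp [Fintype.sum_option, sub_smul]
    abel
  · right
    have h1 := hl none
    have h2 := hl (some none)
    simp at h1 h2
    exact ⟨l, fun k => by simpa using hl (some (some k)), le_antisymm h2 h1, h⟩

variable {I : Type*}

/-- `s` is the zero set on the family of a functional nonnegative on the family. -/
def FF (X : I → V) (s : Set I) : Prop :=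
  ∃ l : V →ₗ[ℝ] ℝ, (∀ i, 0 ≤ l (X i)) ∧ ∀ i, i ∈ s ↔ l (X i) = 0

/-- Pointed family of exposed rays. -/
structure Good (X : I → V) : Prop where
  empty : FF X ∅
  single : ∀ i, FF X {i}

/-- Neighbours. -/
def nb (X : I → V) (i : I) : Set I := {j | j ≠ i ∧ FF X {i, j}}

/-- relative interior of the cone -/
structure RelInt (X : I → V) (o : V) : Prop where
  mem : o ∈ Submodule.span ℝ (range X)
  pos : ∀ l : V →ₗ[ℝ] ℝ, (∀ i, 0 ≤ l (X i)) → (∃ i, l (X i) ≠ 0) → 0 < l o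

lemma FF.univ (X : I → V) : FF X univ := ⟨0, by simp, by simp⟩

lemma FF.inter {X : I → V} {s t : Set I} (hs : FF X s) (ht : FF X t) : FF X (s ∩ t) := by
  obtain ⟨l, hl, hl'⟩ := hs
  obtain ⟨m, hm, hm'⟩ := ht
  refine ⟨l + m, fun i => add_nonneg (hl i) (hm i), fun i => ?_⟩
  rw [mem_inter_iff, hl', hm', LinearMap.add_apply, add_eq_zero_iff_of_nonneg (hl i) (hm i)]

lemma nb_symm {X : I → V} {i j : I} : j ∈ nb X i ↔ i ∈ nb X j := by
  simp only [nb, mem_ofPred_eq, pair_comm i j, ne_comm]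

lemma FF.smul {X : I → V} {a : I → ℝ} (ha : ∀ i, 0 < a i) {s : Set I} :
    FF (fun i => a i • X i) s ↔ FF X s := by
  unfold FF
  refine exists_congr fun l => ?_
  simp only [map_smul, smul_eq_mul, mul_eq_zero, (ha _).ne', false_or, mul_nonneg_iff_of_pos_left (ha _)]

lemma FF.map {W : Type*} [AddCommGroup W] [Module ℝ W] (f : V →ₗ[ℝ] W) (hf : Function.Injective f)
    {X : I → V} {s : Set I} : FF (fun i => f (X i)) s ↔ FF X s := by
  constructor
  · rintro ⟨l, h1, h2⟩
    exact ⟨l.comp f, h1, h2⟩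
  · rintro ⟨l, h1, h2⟩
    obtain ⟨g, hg⟩ := LinearMap.exists_leftInverse_of_injective f (LinearMap.ker_eq_bot.2 hf)
    refine ⟨l.comp g, ?_, ?_⟩
    · intro i; have := LinearMap.congr_fun hg (X i); simp at this; simp [this, h1]
    · intro i; have := LinearMap.congr_fun hg (X i); simp at this; simp [this, h2]

/-- big multiple lemma -/
lemma big_mult [Finite I] (a b : I → ℝ) (ha : ∀ i, 0 ≤ a i) (hb : ∀ i, a i = 0 → 0 ≤ b i) :
    ∃ t : ℝ, ∀ i, 0 ≤ b i + t * a i ∧ (b i + t * a i = 0 ↔ a i = 0 ∧ b i = 0) := by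
  obtain ⟨t, ht⟩ : ∃ t : ℝ, ∀ i, (1 - b i) / a i ≤ t := by
    obtain ⟨t, ht⟩ := (Set.finite_range (fun i => (1 - b i) / a i)).bddAbove
    exact ⟨t, fun i => ht ⟨i, rfl⟩⟩
  refine ⟨t, fun i => ?_⟩
  rcases eq_or_lt_of_le (ha i) with h | h
  · simp [← h, hb i h.symm]
  · have h1 := ht i
    rw [div_le_iff₀ h] at h1
    have : 0 < b i + t * a i := by linarith
    refine ⟨this.le, ?_⟩
    simp [this.ne', h.ne']

lemma FF.trans [Finite I] {X : I → V} {s t : Set I} (hs : FF X s) (hts : t ⊆ s)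
    (ht : ∃ l : V →ₗ[ℝ] ℝ, (∀ i ∈ s, 0 ≤ l (X i)) ∧ ∀ i ∈ s, (i ∈ t ↔ l (X i) = 0)) :
    FF X t := by
  obtain ⟨l, hl, hl'⟩ := hs
  obtain ⟨m, hm, hm'⟩ := ht
  obtain ⟨c, hc⟩ := big_mult (fun i => l (X i)) (fun i => m (X i)) hl
    (fun i hi => hm i ((hl' i).2 hi))
  refine ⟨m + c • l, fun i => by simpa using (hc i).1, fun i => ?_⟩
  have := (hc i).2
  simp only [LinearMap.add_apply, LinearMap.smul_apply, smul_eq_mul]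
  rw [this, ← hl']
  constructor
  · intro h; exact ⟨hts h, (hm' i (hts h)).1 h⟩
  · rintro ⟨h1, h2⟩; exact (hm' i h1).2 h2

/-- Faces of a restriction. -/
lemma FF.restrict [Finite I] {X : I → V} {s : Set I} (hs : FF X s) {t : Set s} :
    FF (fun i : s => X i) t ↔ FF X (Subtype.val '' t) := by
  constructor
  · rintro ⟨l, h1, h2⟩
    refine hs.trans (by rintro _ ⟨x, _, rfl⟩; exact x.2) ⟨l, fun i hi => h1 ⟨i, hi⟩, fun i hi => ?_⟩
    rw [← h2 ⟨i, hi⟩]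
    simp [hi]
  · rintro ⟨l, h1, h2⟩
    refine ⟨l, fun i => h1 i, fun i => ?_⟩
    rw [← h2]; simp

lemma Good.restrict [Finite I] {X : I → V} (hX : Good X) {s : Set I} (hs : FF X s) :
    Good (fun i : s => X i) := by
  constructor
  · rw [hs.restrict]; simpa using hX.empty
  · intro i; rw [hs.restrict]; simpa using hX.single i

lemma Good.posfun {X : I → V} (hX : Good X) : ∃ l : V →ₗ[ℝ] ℝ, ∀ i, 0 < l (X i) := by
  obtain ⟨l, h1, h2⟩ := hX.empty
  exact ⟨l, fun i => lt_of_le_of_ne (h1 i) (fun h => (h2 i).2 h.symm)⟩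

lemma Good.sfun {X : I → V} (hX : Good X) (i : I) :
    ∃ l : V →ₗ[ℝ] ℝ, l (X i) = 0 ∧ ∀ j, j ≠ i → 0 < l (X j) := by
  obtain ⟨l, h1, h2⟩ := hX.single i
  refine ⟨l, (h2 i).1 rfl, fun j hj => lt_of_le_of_ne (h1 j) (fun h => hj ((h2 j).2 h.symm))⟩

lemma Good.ne_zero {X : I → V} (hX : Good X) (i : I) : X i ≠ 0 := by
  obtain ⟨l, h⟩ := hX.posfun
  intro h0
  have := h i
  simp [h0] at this

/-- Generation lemma, dual form. -/
lemma Good.gen [Finite I] {X : I → V} (hX : Good X) (i : I) (l : V →ₗ[ℝ] ℝ) (hi : l (X i) = 0)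
    (hn : ∀ j ∈ nb X i, 0 ≤ l (X j)) (v : I) : 0 ≤ l (X v) := by
  by_contra hv
  push Not at hv
  obtain ⟨li, hi0, hipos⟩ := hX.sfun i
  have hvi : v ≠ i := by rintro rfl; rw [hi] at hv; exact lt_irrefl _ hv
  -- minimiser
  have key : ∀ (s : Set I) (m : V →ₗ[ℝ] ℝ), (∃ a ∈ s, a ≠ i) → m (X i) = 0 → i ∈ s → FF X s →
      ∃ j ∈ s, j ≠ i ∧ (∀ k ∈ s, k ≠ i → m (X j) / li (X j) ≤ m (X k) / li (X k)) ∧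
        FF X {k | k ∈ s ∧ (k = i ∨ m (X k) / li (X k) = m (X j) / li (X j))} := by
    intro s m ⟨a, has, hai⟩ hm his hs
    obtain ⟨j, ⟨hjs, hji⟩, hj⟩ := (s \ {i}).toFinite.exists_minimalFor
      (fun k => m (X k) / li (X k)) _ ⟨a, has, hai⟩
    have hmin : ∀ k ∈ s, k ≠ i → m (X j) / li (X j) ≤ m (X k) / li (X k) := by
      intro k hk hki
      rcases le_total (m (X j) / li (X j)) (m (X k) / li (X k)) with h | h
      · exact h
      · exact hj ⟨hk, hki⟩ h
    refine ⟨j, hjs, hji, hmin, ?_⟩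
    refine hs.trans (fun k hk => hk.1) ⟨m - (m (X j) / li (X j)) • li, ?_, ?_⟩
    · intro k hk
      by_cases hki : k = i
      · subst hki; simp [hm, hi0]
      · have := hmin k hk hki
        rw [le_div_iff₀ (hipos k hki)] at this
        simp only [LinearMap.sub_apply, LinearMap.smul_apply, smul_eq_mul]
        linarith
    · intro k hk
      by_cases hki : k = i
      · subst hki; simp [hm, hi0, hk]
      · simp only [LinearMap.sub_apply, LinearMap.smul_apply, smul_eq_mul, mem_ofPred_eq, hk, hki,
          true_and, false_or]
        rw [div_eq_iff (hipos k hki).ne', sub_eq_zero]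
  obtain ⟨j0, -, hj0i, hmin0, hM⟩ := key univ l ⟨v, trivial, hvi⟩ hi trivial (FF.univ X)
  set M := {k | k ∈ (univ : Set I) ∧ (k = i ∨ l (X k) / li (X k) = l (X j0) / li (X j0))} with hMdef
  -- minimal face
  obtain ⟨s, ⟨hsM, hsF, his, a, has, hai⟩, hsmin⟩ :=
    ({s : Set I | s ⊆ M ∧ FF X s ∧ i ∈ s ∧ ∃ a ∈ s, a ≠ i}).toFinite.exists_minimal
      ⟨M, subset_rfl, hM, ⟨trivial, Or.inl rfl⟩, j0, ⟨trivial, Or.inr rfl⟩, hj0i⟩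
  have hneg : ∀ k ∈ M, k ≠ i → l (X k) < 0 := by
    rintro k ⟨-, hk⟩ hki
    have h1 : l (X k) / li (X k) = l (X j0) / li (X j0) := by tauto
    have h2 := hmin0 v trivial hvi
    rw [← h1] at h2
    have h3 : l (X v) / li (X v) < 0 := div_neg_of_neg_of_pos hv (hipos v hvi)
    have h4 := lt_of_le_of_lt h2 h3
    by_contra h5
    push Not at h5
    exact absurd h4 (not_lt.2 (div_nonneg h5 (hipos k hki).le))
  have hs2 : s = {i, a} := by
    ext b
    constructor
    · intro hb
      by_contra hb2
      simp only [mem_insert_iff, mem_singleton_iff, not_or] at hb2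
      obtain ⟨la, la0, lapos⟩ := hX.sfun a
      obtain ⟨lb, lb0, lbpos⟩ := hX.sfun b
      obtain ⟨j, hjs, hji, hjmin, hjF⟩ := key s (lb (X i) • la - la (X i) • lb) ⟨a, has, hai⟩
        (by simp [mul_comm]) his hsF
      have hsub := hsmin (y := {k | k ∈ s ∧ (k = i ∨ _ )}) ⟨fun k hk => hsM hk.1, hjF, ⟨his, Or.inl rfl⟩, j, ⟨hjs, Or.inr rfl⟩, hji⟩
        (fun k hk => hk.1)
      have e1 := (hsub has).2
      have e2 := (hsub hb).2
      simp only [hai, hb2.1, false_or] at e1 e2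
      rw [← e2] at e1
      simp only [LinearMap.sub_apply, LinearMap.smul_apply, smul_eq_mul, la0, lb0] at e1
      have f1 : (lb (X i) * 0 - la (X i) * lb (X a)) / li (X a) < 0 := by
        apply div_neg_of_neg_of_pos _ (hipos a hai)
        have := mul_pos (lapos i (Ne.symm hai)) (lbpos a (Ne.symm hb2.2))
        linarith
      have f2 : 0 < (lb (X i) * la (X b) - la (X i) * 0) / li (X b) := by
        apply div_pos _ (hipos b hb2.1)
        have := mul_pos (lbpos i (Ne.symm hb2.1)) (lapos b hb2.2)
        linarith
      linarith
    · rintro (rfl | rfl) <;> assumption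
  have h1 := hneg a (hsM has) hai
  have h2 := hn a ⟨hai, hs2 ▸ hsF⟩
  linarith

/-- Connectivity of the neighbour graph. -/
lemma Good.conn [Finite I] {X : I → V} (hX : Good X) (T : Set I) (hT : T.Nonempty)
    (hcl : ∀ i ∈ T, ∀ j ∈ nb X i, j ∈ T) (v : I) : v ∈ T := by
  obtain ⟨l0, h0⟩ := hX.posfun
  obtain ⟨lv, hv0, hvpos⟩ := hX.sfun v
  obtain ⟨i, hiT, hi⟩ := T.toFinite.exists_minimalFor (fun i => lv (X i) / l0 (X i)) _ hT
  by_cases hiv : i = v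
  · exact hiv ▸ hiT
  exfalso
  have hpos : 0 < lv (X i) / l0 (X i) := div_pos (hvpos i hiv) (h0 i)
  have := hX.gen i (lv - (lv (X i) / l0 (X i)) • l0) (by simp [(h0 i).ne']) (by
    intro j hj
    have hjT := hcl i hiT j hj
    have : lv (X i) / l0 (X i) ≤ lv (X j) / l0 (X j) := by
      rcases le_total (lv (X i) / l0 (X i)) (lv (X j) / l0 (X j)) with h | h
      · exact h
      · exact hi hjT h
    rw [le_div_iff₀ (h0 j)] at this
    simp only [LinearMap.sub_apply, LinearMap.smul_apply, smul_eq_mul]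
    linarith) v
  simp only [LinearMap.sub_apply, LinearMap.smul_apply, smul_eq_mul, hv0] at this
  have := mul_pos hpos (h0 v)
  linarith

end Basic
end ISim

namespace ISim

section Link

variable {V : Type*} [AddCommGroup V] [Module ℝ V]
variable {W : Type*} [AddCommGroup W] [Module ℝ W]
variable {I : Type*}

/-- Generation lemma, primal form. -/
lemma Good.gen' [Fintype I] {X : I → V} (hX : Good X) (i v : I) :
    ∃ t : ℝ, ∃ c : I → ℝ, (∀ j, 0 ≤ c j) ∧ (∀ j, j ∉ nb X i → c j = 0) ∧
      X v = t • X i + ∑ j, c j • X j := by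
  classical
  rcases farkas_line (fun j : I => if j ∈ nb X i then X j else 0) (X i) (X v) with
    ⟨c, t, hc, h⟩ | ⟨l, h1, h2, h3⟩
  · refine ⟨t, fun j => if j ∈ nb X i then c j else 0, ?_, ?_, ?_⟩
    · intro j; dsimp only; split_ifs <;> simp [hc]
    · intro j hj; simp [hj]
    · rw [h]
      congr 1
      apply Finset.sum_congr rfl
      intro j _
      dsimp only
      split_ifs <;> simp
  · exfalso
    have := hX.gen i l h2 (fun j hj => by have := h1 j; simpa [hj] using this) v
    linarith

/-- Hypotheses for the projection defining a link. -/
structure LinkMap (X : I → V) (i : I) (π : V →ₗ[ℝ] W) : Prop where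
  zero : π (X i) = 0
  ker : ∀ x, π x = 0 → ∃ t : ℝ, x = t • X i

/-- Link family. -/
def lk (X : I → V) (i : I) (π : V →ₗ[ℝ] W) : nb X i → W := fun j => π (X j)

lemma factor {π : V →ₗ[ℝ] W} {l : V →ₗ[ℝ] ℝ} (h : ∀ x, π x = 0 → l x = 0) :
    ∃ m : W →ₗ[ℝ] ℝ, ∀ x, m (π x) = l x := by
  have : l ∈ LinearMap.range π.dualMap := by
    rw [LinearMap.range_dualMap_eq_dualAnnihilator_ker, Submodule.mem_dualAnnihilator]
    intro x hx; exact h x hx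
  obtain ⟨m, hm⟩ := this
  exact ⟨m, fun x => by rw [← hm]; rfl⟩

lemma LinkMap.face [Finite I] {X : I → V} (hX : Good X) {i : I} {π : V →ₗ[ℝ] W}
    (hπ : LinkMap X i π) (s' : Set (nb X i)) :
    FF (lk X i π) s' ↔ ∃ s, FF X s ∧ i ∈ s ∧ s' = Subtype.val ⁻¹' s := by
  constructor
  · rintro ⟨m, h1, h2⟩
    refine ⟨{j | m (π (X j)) = 0}, ⟨m.comp π, ?_, fun j => Iff.rfl⟩, ?_, ?_⟩
    · intro j
      exact hX.gen i (m.comp π) (by simp [hπ.zero]) (fun j hj => h1 ⟨j, hj⟩) j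
    · simp [hπ.zero]
    · ext j; exact h2 j
  · rintro ⟨s, ⟨l, h1, h2⟩, hi, rfl⟩
    obtain ⟨m, hm⟩ := factor (π := π) (l := l) (by
      intro x hx
      obtain ⟨t, rfl⟩ := hπ.ker x hx
      simp [(h2 i).1 hi])
    refine ⟨m, fun j => by simp [lk, hm, h1], fun j => by simp [lk, hm, h2]⟩

lemma LinkMap.good [Finite I] {X : I → V} (hX : Good X) {i : I} {π : V →ₗ[ℝ] W}
    (hπ : LinkMap X i π) : Good (lk X i π) := by
  constructor
  · rw [hπ.face hX]
    refine ⟨{i}, hX.single i, rfl, ?_⟩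
    ext ⟨j, hj⟩
    simpa using hj.1
  · intro j
    rw [hπ.face hX]
    refine ⟨{i, j.1}, j.2.2, by simp, ?_⟩
    ext ⟨k, hk⟩
    have := hk.1
    simp [this, Subtype.ext_iff]

lemma LinkMap.relInt [Finite I] {X : I → V} (hX : Good X) {i : I} {π : V →ₗ[ℝ] W}
    (hπ : LinkMap X i π) {o : V} (ho : RelInt X o) : RelInt (lk X i π) (π o) := by
  cases nonempty_fintype I
  constructor
  · have : Submodule.span ℝ (range X) ≤ (Submodule.span ℝ (range (lk X i π))).comap π := by
      rw [Submodule.span_le]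
      rintro _ ⟨v, rfl⟩
      obtain ⟨t, c, hc, hc0, h⟩ := hX.gen' i v
      simp only [SetLike.mem_coe, Submodule.mem_comap]
      rw [h, map_add, map_smul, hπ.zero, smul_zero, zero_add, map_sum]
      refine Submodule.sum_mem _ fun j _ => ?_
      by_cases hj : j ∈ nb X i
      · rw [map_smul]
        exact Submodule.smul_mem _ _ (Submodule.subset_span ⟨⟨j, hj⟩, rfl⟩)
      · simp [hc0 j hj]
    exact this ho.mem
  · rintro l hl ⟨j, hj⟩
    refine ho.pos (l.comp π) ?_ ⟨j, hj⟩
    intro j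
    exact hX.gen i (l.comp π) (by simp [hπ.zero]) (fun j hj => hl ⟨j, hj⟩) j

/-- rank -/
noncomputable def rk (X : I → V) : ℕ := Module.finrank ℝ (Submodule.span ℝ (range X))

lemma rk_empty [IsEmpty I] (X : I → V) : rk X = 0 := by
  have : Submodule.span ℝ (range X) = ⊥ := by rw [range_eq_empty, Submodule.span_empty]
  unfold ISim.rk
  rw [this]
  exact finrank_bot ℝ V

lemma LinkMap.rk [Finite I] {X : I → V} (hX : Good X) {i : I} {π : V →ₗ[ℝ] W}
    (hπ : LinkMap X i π) : rk X = rk (lk X i π) + 1 := by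
  cases nonempty_fintype I
  have hfin : FiniteDimensional ℝ (Submodule.span ℝ (range X)) :=
    FiniteDimensional.span_of_finite ℝ (finite_range X)
  have hmap : (Submodule.span ℝ (range X)).map π = Submodule.span ℝ (range (lk X i π)) := by
    apply le_antisymm
    · rw [Submodule.map_le_iff_le_comap, Submodule.span_le]
      rintro _ ⟨v, rfl⟩
      obtain ⟨t, c, hc, hc0, h⟩ := hX.gen' i v
      simp only [SetLike.mem_coe, Submodule.mem_comap]
      rw [h, map_add, map_smul, hπ.zero, smul_zero, zero_add, map_sum]
      refine Submodule.sum_mem _ fun j _ => ?_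
      by_cases hj : j ∈ nb X i
      · rw [map_smul]
        exact Submodule.smul_mem _ _ (Submodule.subset_span ⟨⟨j, hj⟩, rfl⟩)
      · simp [hc0 j hj]
    · rw [Submodule.span_le]
      rintro _ ⟨v, rfl⟩
      exact ⟨X v, Submodule.subset_span ⟨_, rfl⟩, rfl⟩
  have h1 := LinearMap.finrank_range_add_finrank_ker (π.domRestrict (Submodule.span ℝ (range X)))
  rw [LinearMap.range_domRestrict, hmap] at h1
  have h2 : Module.finrank ℝ (LinearMap.ker (π.domRestrict (Submodule.span ℝ (range X)))) = 1 := by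
    have hmem : X i ∈ Submodule.span ℝ (range X) := Submodule.subset_span ⟨i, rfl⟩
    rw [finrank_eq_one_iff_of_nonzero' (⟨⟨X i, hmem⟩, by simp [hπ.zero]⟩)]
    · rintro ⟨⟨x, hx⟩, hx'⟩
      simp at hx'
      obtain ⟨t, ht⟩ := hπ.ker x hx'
      exact ⟨t, by simp [ht]⟩
    · simp [Subtype.ext_iff, hX.ne_zero i]
  unfold ISim.rk
  omega

lemma linkMap_mkQ (X : I → V) (i : I) :
    LinkMap X i (Submodule.span ℝ {X i}).mkQ := by
  constructor
  · simp [Submodule.mem_span_singleton_self]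
  · intro x hx
    rw [Submodule.mkQ_apply, Submodule.Quotient.mk_eq_zero, Submodule.mem_span_singleton] at hx
    obtain ⟨t, rfl⟩ := hx
    exact ⟨t, rfl⟩

/-- combinatorially same -/
def Same (X : I → V) (Y : I → W) : Prop := ∀ s, FF X s ↔ FF Y s

lemma Same.symm {X : I → V} {Y : I → W} (h : Same X Y) : Same Y X := fun s => (h s).symm

lemma Same.good {X : I → V} {Y : I → W} (h : Same X Y) (hX : Good X) : Good Y :=
  ⟨(h _).1 hX.empty, fun i => (h _).1 (hX.single i)⟩

lemma Same.nb {X : I → V} {Y : I → W} (h : Same X Y) (i : I) : nb X i = nb Y i := by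
  ext j; exact and_congr Iff.rfl (h _)

/-- Link of `Y` on neighbours of `X`. -/
def lk2 (X : I → V) (Y : I → W) (i : I) {W' : Type*} [AddCommGroup W'] [Module ℝ W']
    (π : W →ₗ[ℝ] W') : ISim.nb X i → W' := fun j => π (Y j)

lemma Same.lk2_eq {X : I → V} {Y : I → W} (h : Same X Y) (i : I) {W' : Type*} [AddCommGroup W']
    [Module ℝ W'] (π : W →ₗ[ℝ] W') :
    lk2 X Y i π = lk Y i π ∘ (fun j => ⟨j.1, h.nb i ▸ j.2⟩) := rfl

lemma lk2_self (X : I → V) (i : I) (π : V →ₗ[ℝ] W) : lk2 X X i π = lk X i π := rfl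

lemma Same.lk2_face [Finite I] {X : I → V} {Y : I → W} (hX : Good X) (h : Same X Y) (i : I)
    {W' : Type*} [AddCommGroup W'] [Module ℝ W'] {π : W →ₗ[ℝ] W'} (hπ : LinkMap Y i π)
    (s' : Set (ISim.nb X i)) :
    FF (lk2 X Y i π) s' ↔ ∃ s, FF X s ∧ i ∈ s ∧ s' = Subtype.val ⁻¹' s := by
  have hY := h.good hX
  constructor
  · rintro ⟨m, h1, h2⟩
    refine ⟨{j | m (π (Y j)) = 0}, (h _).2 ⟨m.comp π, ?_, fun j => Iff.rfl⟩, ?_, ?_⟩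
    · intro j
      exact hY.gen i (m.comp π) (by simp [hπ.zero])
        (fun j hj => h1 ⟨j, (h.nb i).symm ▸ hj⟩) j
    · simp [hπ.zero]
    · ext j; exact h2 j
  · rintro ⟨s, hs, hi, rfl⟩
    obtain ⟨l, h1, h2⟩ := (h _).1 hs
    obtain ⟨m, hm⟩ := factor (π := π) (l := l) (by
      intro x hx
      obtain ⟨t, rfl⟩ := hπ.ker x hx
      simp [(h2 i).1 hi])
    refine ⟨m, fun j => by simp [lk2, hm, h1], fun j => by simp [lk2, hm, h2]⟩

lemma Same.lk2_same [Finite I] {X : I → V} {Y : I → W} (hX : Good X) (h : Same X Y) (i : I)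
    {V' : Type*} [AddCommGroup V'] [Module ℝ V'] {ρ : V →ₗ[ℝ] V'} (hρ : LinkMap X i ρ)
    {W' : Type*} [AddCommGroup W'] [Module ℝ W'] {π : W →ₗ[ℝ] W'} (hπ : LinkMap Y i π) :
    Same (lk X i ρ) (lk2 X Y i π) := by
  intro s
  rw [hρ.face hX, h.lk2_face hX i hπ]

lemma Same.range_lk2 {X : I → V} {Y : I → W} (h : Same X Y) (i : I) {W' : Type*} [AddCommGroup W']
    [Module ℝ W'] (π : W →ₗ[ℝ] W') : range (lk2 X Y i π) = range (lk Y i π) := by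
  ext x
  constructor
  · rintro ⟨j, rfl⟩; exact ⟨⟨j.1, h.nb i ▸ j.2⟩, rfl⟩
  · rintro ⟨j, rfl⟩; exact ⟨⟨j.1, (h.nb i).symm ▸ j.2⟩, rfl⟩

lemma Same.lk2_rk [Finite I] {X : I → V} {Y : I → W} (hX : Good X) (h : Same X Y) (i : I)
    {W' : Type*} [AddCommGroup W'] [Module ℝ W'] {π : W →ₗ[ℝ] W'} (hπ : LinkMap Y i π) :
    rk Y = rk (lk2 X Y i π) + 1 := by
  rw [hπ.rk (h.good hX)]; unfold rk; rw [h.range_lk2 i]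

lemma Same.lk2_relInt [Finite I] {X : I → V} {Y : I → W} (hX : Good X) (h : Same X Y) (i : I)
    {W' : Type*} [AddCommGroup W'] [Module ℝ W'] {π : W →ₗ[ℝ] W'} (hπ : LinkMap Y i π) {o : W}
    (ho : RelInt Y o) : RelInt (lk2 X Y i π) (π o) := by
  have := hπ.relInt (h.good hX) ho
  constructor
  · rw [h.range_lk2 i]; exact this.mem
  · rintro l hl ⟨j, hj⟩
    exact this.pos l (fun j => hl ⟨j.1, (h.nb i).symm ▸ j.2⟩) ⟨⟨j.1, h.nb i ▸ j.2⟩, hj⟩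

lemma card_nb_lt [Finite I] (X : I → V) (i : I) : Nat.card (nb X i) < Nat.card I :=
  Set.Finite.card_lt_card (s := nb X i) (t := univ) (toFinite _)
    ⟨subset_univ _, fun h => (h (mem_univ i)).1 rfl⟩ |>.trans_eq (by simp)

end Link

lemma Same.rk_aux.{u, v, w} : ∀ n : ℕ, ∀ (I : Type u) [Finite I] (V : Type v) [AddCommGroup V]
    [Module ℝ V] (W : Type w) [AddCommGroup W] [Module ℝ W] (X : I → V) (Y : I → W),
    Nat.card I < n → Good X → Same X Y → rk X = rk Y := by
  intro n
  induction n with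
  | zero => intros; omega
  | succ n ih =>
    intro I _ V _ _ W _ _ X Y hn hX h
    rcases isEmpty_or_nonempty I with hI | ⟨⟨i⟩⟩
    · rw [rk_empty, rk_empty]
    · rw [(linkMap_mkQ X i).rk hX, h.lk2_rk hX i (linkMap_mkQ Y i)]
      congr 1
      apply ih
      · have := card_nb_lt X i; omega
      · exact (linkMap_mkQ X i).good hX
      · exact h.lk2_same hX i (linkMap_mkQ X i) (linkMap_mkQ Y i)

section Small
variable {V : Type*} [AddCommGroup V] [Module ℝ V]
variable {W : Type*} [AddCommGroup W] [Module ℝ W]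
variable {I : Type*}

lemma Same.rk [Finite I] {X : I → V} {Y : I → W} (hX : Good X) (h : Same X Y) : rk X = rk Y :=
  Same.rk_aux (Nat.card I + 1) I V W X Y (by omega) hX h

lemma Good.empty_of_rk_zero [Finite I] {X : I → V} (hX : Good X) (h : ISim.rk X = 0) : IsEmpty I := by
  by_contra hI
  rw [not_isEmpty_iff] at hI
  obtain ⟨i⟩ := hI
  have := (linkMap_mkQ X i).rk hX
  omega

lemma Good.rk_one [Finite I] {X : I → V} (hX : Good X) (h : ISim.rk X = 1) (i j : I) : i = j := by
  have := (linkMap_mkQ X i).rk hX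
  have hE := ((linkMap_mkQ X i).good hX).empty_of_rk_zero (by omega)
  have := hX.conn {i} ⟨i, rfl⟩ (by rintro k rfl l hl; exact (hE.false ⟨l, hl⟩).elim) j
  exact (mem_singleton_iff.1 this).symm

lemma Good.nb_nonempty [Finite I] {X : I → V} (hX : Good X) (h : 2 ≤ ISim.rk X) (i : I) :
    (nb X i).Nonempty := by
  by_contra hE
  rw [not_nonempty_iff_eq_empty] at hE
  have h1 := (linkMap_mkQ X i).rk hX
  have : IsEmpty (nb X i) := by rw [hE]; infer_instance
  have h2 : ISim.rk (lk X i (Submodule.span ℝ {X i}).mkQ) = 0 := by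
    exact rk_empty _
  omega

lemma Good.rk_two [Finite I] {X : I → V} (hX : Good X) (h : ISim.rk X = 2) (i : I) :
    ∃ j, j ≠ i ∧ FF X {i, j} ∧ ∀ k, k = i ∨ k = j := by
  obtain ⟨j, hj⟩ := hX.nb_nonempty (by omega) i
  have hnb : ∀ i : I, ∀ j ∈ nb X i, ∀ k ∈ nb X i, k = j := by
    intro i j hj k hk
    have h1 := (linkMap_mkQ X i).rk hX
    have := ((linkMap_mkQ X i).good hX).rk_one (by omega) ⟨k, hk⟩ ⟨j, hj⟩
    exact congrArg Subtype.val this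
  refine ⟨j, hj.1, hj.2, fun k => ?_⟩
  have := hX.conn {i, j} ⟨i, by simp⟩ (by
    rintro a (rfl | rfl) b hb
    · right; exact hnb a j hj b hb
    · left; exact hnb a i (nb_symm.1 hj) b hb) k
  exact this

lemma Good.rk_three [Finite I] {X : I → V} (hX : Good X) (h : ISim.rk X = 3) (i : I) :
    ∃ j l, j ≠ l ∧ nb X i = {j, l} := by
  have h1 := (linkMap_mkQ X i).rk hX
  obtain ⟨j, hj⟩ := hX.nb_nonempty (by omega) i
  obtain ⟨l, hl, -, h2⟩ := ((linkMap_mkQ X i).good hX).rk_two (by omega) ⟨j, hj⟩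
  refine ⟨j, l.1, fun hh => hl (Subtype.ext hh.symm), ?_⟩
  ext k
  constructor
  · intro hk
    rcases h2 ⟨k, hk⟩ with h3 | h3
    · left; exact congrArg Subtype.val h3
    · right; exact congrArg Subtype.val h3
  · rintro (rfl | rfl)
    · exact hj
    · exact l.2

lemma pair_ne_univ [Finite I] {X : I → V} (h : 3 ≤ ISim.rk X) (i j : I) : ({i, j} : Set I) ≠ univ := by
  classical
  intro hU
  have hr : range X = {X i, X j} := by
    rw [← image_univ, ← hU, image_pair]
  have : ISim.rk X ≤ 2 := by
    unfold ISim.rk; rw [hr]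
    have := finrank_span_finset_le_card (R := ℝ) ({X i, X j} : Finset V)
    rw [Set.finrank] at this
    rw [Finset.coe_insert, Finset.coe_singleton] at this
    exact this.trans Finset.card_le_two
  omega

end Small

end ISim

namespace ISim

/-- planar determinant -/
def dt (z w : ℂ) : ℝ := z.re * w.im - z.im * w.re

lemma dt_pos_angle {z w : ℂ} (h : 0 < dt z w) :
    (InnerProductGeometry.angle z w = w.arg - z.arg) ∨
    (InnerProductGeometry.angle z w = w.arg - z.arg + 2 * Real.pi ∧ 0 ≤ z.im ∧ w.im < 0) := by
  have hz : z ≠ 0 := by rintro rfl; simp [dt] at h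
  have hw : w ≠ 0 := by rintro rfl; simp [dt] at h
  have hnz : 0 < Complex.normSq z := Complex.normSq_pos.2 hz
  have him : 0 < (w / z).im := by
    rw [Complex.div_im]
    have : w.im * z.re / Complex.normSq z - w.re * z.im / Complex.normSq z
      = dt z w / Complex.normSq z := by unfold dt; ring
    rw [this]; positivity
  have h1 : 0 < (w / z).arg := by
    rcases lt_or_eq_of_le (Complex.arg_nonneg_iff.2 him.le) with h | h
    · exact h
    · have := Complex.arg_eq_zero_iff.1 h.symm; linarith [this.2]
  have h2 : (w / z).arg < Real.pi := by
    rcases lt_or_eq_of_le (Complex.arg_le_pi (w / z)) with h | h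
    · exact h
    · have := Complex.arg_eq_pi_iff.1 h; linarith [this.2]
  have ha : InnerProductGeometry.angle z w = (w / z).arg := by
    rw [InnerProductGeometry.angle_comm, Complex.angle_eq_abs_arg hw hz, abs_of_pos h1]
  rw [ha]
  have hc := Complex.arg_div_coe_angle hw hz
  rw [← Real.Angle.coe_sub, Real.Angle.angle_eq_iff_two_pi_dvd_sub] at hc
  obtain ⟨k, hk⟩ := hc
  have b1 := Complex.arg_le_pi w
  have b2 := Complex.neg_pi_lt_arg w
  have b3 := Complex.arg_le_pi z
  have b4 := Complex.neg_pi_lt_arg z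
  have hpi := Real.pi_pos
  have k1 : (-1 : ℝ) < k := by
    by_contra hh; push Not at hh
    have : 2 * Real.pi * k ≤ 2 * Real.pi * (-1) := by gcongr
    linarith
  have k2 : (k : ℝ) < 2 := by
    by_contra hh; push Not at hh
    have : 2 * Real.pi * 2 ≤ 2 * Real.pi * k := by gcongr
    linarith
  have k1' : -1 < k := by exact_mod_cast k1
  have k2' : k < 2 := by exact_mod_cast k2
  have : k = 0 ∨ k = 1 := by omega
  rcases this with rfl | rfl
  · left; simp at hk; linarith
  · right
    simp at hk
    refine ⟨by linarith, ?_, ?_⟩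
    · rw [← Complex.arg_nonneg_iff]; linarith
    · rw [← Complex.arg_neg_iff]; linarith

section AS

variable {V : Type*} [AddCommGroup V] [Module ℝ V]
variable {I : Type*}

lemma relInt_pos_of_face {X : I → V} {o : V} (ho : RelInt X o) {l : V →ₗ[ℝ] ℝ} {s : Set I}
    (h1 : ∀ i, 0 ≤ l (X i)) (h2 : ∀ i, i ∈ s ↔ l (X i) = 0) (hs : s ≠ univ) : 0 < l o := by
  apply ho.pos l h1
  by_contra hh
  push Not at hh
  exact hs (eq_univ_of_forall fun i => (h2 i).2 (hh i))

lemma relInt_rep [Finite I] {X : I → V} (hX : Good X) (hr : rk X = 3) {o : V} (ho : RelInt X o)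
    {i j l : I} (hjl : j ≠ l) (hn : nb X i = {j, l}) :
    ∃ a b c : ℝ, 0 < a ∧ 0 < b ∧ o = a • X j + b • X l + c • X i := by
  cases nonempty_fintype I
  have hj : j ∈ nb X i := by rw [hn]; simp
  have hl : l ∈ nb X i := by rw [hn]; simp
  have hspan : Submodule.span ℝ (range X) ≤ Submodule.span ℝ {X j, X l, X i} := by
    rw [Submodule.span_le]
    rintro _ ⟨v, rfl⟩
    obtain ⟨t, c, hc, hc0, h⟩ := hX.gen' i v
    simp only [SetLike.mem_coe]
    rw [h]
    refine Submodule.add_mem _ (Submodule.smul_mem _ _ (Submodule.subset_span (by simp)))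
      (Submodule.sum_mem _ fun k _ => ?_)
    by_cases hk : k ∈ nb X i
    · apply Submodule.smul_mem _ _ (Submodule.subset_span _)
      rw [hn] at hk
      rcases hk with rfl | rfl <;> simp
    · simp [hc0 k hk]
  have := hspan ho.mem
  rw [Submodule.mem_span_triple] at this
  obtain ⟨a, b, c, h⟩ := this
  refine ⟨a, b, c, ?_, ?_, h.symm⟩
  · obtain ⟨m, h1, h2⟩ := hl.2
    have hp := relInt_pos_of_face ho h1 h2 (pair_ne_univ (X := X) (by omega) _ _)
    rw [← h] at hp
    simp only [map_add, map_smul, smul_eq_mul, (h2 i).1 (by simp), (h2 l).1 (by simp)] at hp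
    have hnn := h1 j
    by_contra hh
    push Not at hh
    nlinarith
  · obtain ⟨m, h1, h2⟩ := hj.2
    have hp := relInt_pos_of_face ho h1 h2 (pair_ne_univ (X := X) (by omega) _ _)
    rw [← h] at hp
    simp only [map_add, map_smul, smul_eq_mul, (h2 i).1 (by simp), (h2 j).1 (by simp)] at hp
    have hnn := h1 l
    by_contra hh
    push Not at hh
    nlinarith

variable {X : I → V} {o : V} {ϖ : V →ₗ[ℝ] ℂ}

lemma as_ne_zero [Finite I] (hX : Good X) (hr : rk X = 3) (ho : RelInt X o)
    (hk : ∀ x ∈ Submodule.span ℝ (range X), ϖ x = 0 → ∃ t : ℝ, x = t • o) (i : I) :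
    ϖ (X i) ≠ 0 := by
  intro h
  obtain ⟨t, ht⟩ := hk _ (Submodule.subset_span ⟨i, rfl⟩) h
  obtain ⟨l, h1, h2⟩ := hX.single i
  have hp := relInt_pos_of_face ho h1 h2 (by simpa using pair_ne_univ (X := X) (by omega) i i)
  have h3 := (h2 i).1 rfl
  rw [ht, map_smul, smul_eq_mul] at h3
  have ht0 : t = 0 := by
    rcases mul_eq_zero.1 h3 with h | h
    · exact h
    · exact absurd h hp.ne'
  exact hX.ne_zero i (by rw [ht, ht0, zero_smul])

lemma as_dt_ne_zero [Finite I] (hX : Good X) (hr : rk X = 3) (ho : RelInt X o)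
    (hk : ∀ x ∈ Submodule.span ℝ (range X), ϖ x = 0 → ∃ t : ℝ, x = t • o) {i j : I}
    (hj : j ∈ nb X i) : dt (ϖ (X i)) (ϖ (X j)) ≠ 0 := by
  intro h
  have hi0 := as_ne_zero hX hr ho hk i
  have hj0 := as_ne_zero hX hr ho hk j
  obtain ⟨a, b, ha, hab⟩ : ∃ a b : ℝ, b ≠ 0 ∧ a • ϖ (X i) + b • ϖ (X j) = 0 := by
    by_cases hre : (ϖ (X i)).re = 0
    · have him : (ϖ (X i)).im ≠ 0 := fun h' => hi0 (Complex.ext hre h')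
      refine ⟨-(ϖ (X j)).im, (ϖ (X i)).im, him, ?_⟩
      unfold dt at h
      apply Complex.ext <;> simp <;> linarith
    · refine ⟨-(ϖ (X j)).re, (ϖ (X i)).re, hre, ?_⟩
      unfold dt at h
      apply Complex.ext <;> simp <;> linarith
  obtain ⟨t, ht⟩ := hk (a • X i + b • X j)
    (Submodule.add_mem _ (Submodule.smul_mem _ _ (Submodule.subset_span ⟨i, rfl⟩))
      (Submodule.smul_mem _ _ (Submodule.subset_span ⟨j, rfl⟩))) (by simpa using hab)
  obtain ⟨l, h1, h2⟩ := hj.2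
  have hp := relInt_pos_of_face ho h1 h2 (pair_ne_univ (X := X) (by omega) _ _)
  have ht0 : t = 0 := by
    have := congrArg l ht
    simp only [map_add, map_smul, smul_eq_mul, (h2 i).1 (by simp), (h2 j).1 (by simp)] at this
    simp [hp.ne'] at this
    exact this
  obtain ⟨m, m0, mpos⟩ := hX.sfun i
  have := congrArg m ht
  simp only [map_add, map_smul, smul_eq_mul, m0, ht0] at this
  simp [ha, (mpos j hj.1).ne'] at this

lemma dt_swap (z w : ℂ) : dt w z = - dt z w := by unfold dt; ring

lemma as_opp [Finite I] (hX : Good X) (hr : rk X = 3) (ho : RelInt X o) (ho0 : ϖ o = 0)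
    {i j l : I} (hjl : j ≠ l) (hn : nb X i = {j, l}) (h : 0 < dt (ϖ (X i)) (ϖ (X j))) :
    dt (ϖ (X i)) (ϖ (X l)) < 0 := by
  obtain ⟨a, b, c, ha, hb, ho'⟩ := relInt_rep hX hr ho hjl hn
  have h0 : a • ϖ (X j) + b • ϖ (X l) + c • ϖ (X i) = 0 := by
    rw [← ho0, ho']; simp
  have hre := congrArg Complex.re h0
  have him := congrArg Complex.im h0
  simp at hre him
  have : a * dt (ϖ (X i)) (ϖ (X j)) + b * dt (ϖ (X i)) (ϖ (X l)) = 0 := by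
    unfold dt
    linear_combination (ϖ (X i)).re * him - (ϖ (X i)).im * hre
  by_contra hh
  push Not at hh
  nlinarith [mul_pos ha h, mul_nonneg hb.le hh]

/-- Structure of neighbours: one next, one previous. -/
lemma as_next [Finite I] (hX : Good X) (hr : rk X = 3) (ho : RelInt X o) (ho0 : ϖ o = 0)
    (hk : ∀ x ∈ Submodule.span ℝ (range X), ϖ x = 0 → ∃ t : ℝ, x = t • o) (i : I) :
    ∃ n p, n ≠ p ∧ nb X i = {n, p} ∧ 0 < dt (ϖ (X i)) (ϖ (X n)) ∧ dt (ϖ (X i)) (ϖ (X p)) < 0 := by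
  obtain ⟨j, l, hjl, hn⟩ := hX.rk_three hr i
  have hj : j ∈ nb X i := by rw [hn]; simp
  rcases lt_or_gt_of_ne (as_dt_ne_zero hX hr ho hk hj) with h | h
  · have hl : l ∈ nb X i := by rw [hn]; simp
    have hd : 0 < dt (ϖ (X i)) (ϖ (X l)) := by
      rcases lt_or_gt_of_ne (as_dt_ne_zero hX hr ho hk hl) with h' | h'
      · exfalso
        obtain ⟨a, b, c, ha, hb, ho'⟩ := relInt_rep hX hr ho hjl hn
        have h0 : a • ϖ (X j) + b • ϖ (X l) + c • ϖ (X i) = 0 := by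
          rw [← ho0, ho']; simp
        have hre := congrArg Complex.re h0
        have him := congrArg Complex.im h0
        simp at hre him
        have : a * dt (ϖ (X i)) (ϖ (X j)) + b * dt (ϖ (X i)) (ϖ (X l)) = 0 := by
          unfold dt
          linear_combination (ϖ (X i)).re * him - (ϖ (X i)).im * hre
        nlinarith [mul_pos_of_neg_of_neg (neg_neg_of_pos ha) h,
          mul_pos_of_neg_of_neg (neg_neg_of_pos hb) h']
      · exact h'
    exact ⟨l, j, hjl.symm, by rw [hn, pair_comm], hd, h⟩
  · exact ⟨j, l, hjl, hn, h, as_opp hX hr ho ho0 hjl hn h⟩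

lemma as_cross [Finite I] (hr : rk X = 3) (ho : RelInt X o)
    (hk : ∀ x ∈ Submodule.span ℝ (range X), ϖ x = 0 → ∃ t : ℝ, x = t • o) {i n i' n' : I}
    (hn : n ∈ nb X i) (hn' : n' ∈ nb X i')
    (h1 : 0 ≤ (ϖ (X i)).im) (h2 : (ϖ (X n)).im < 0) (h3 : 0 < dt (ϖ (X i)) (ϖ (X n)))
    (h1' : 0 ≤ (ϖ (X i')).im) (h2' : (ϖ (X n')).im < 0) (h3' : 0 < dt (ϖ (X i')) (ϖ (X n'))) :
    i = i' := by
  have rep : ∀ i n : I, 0 ≤ (ϖ (X i)).im → (ϖ (X n)).im < 0 → 0 < dt (ϖ (X i)) (ϖ (X n)) →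
      ∃ a b : ℝ, 0 < a ∧ 0 ≤ b ∧ ϖ (a • X i + b • X n) = -1 := by
    intro i n h1 h2 h3
    refine ⟨-(ϖ (X n)).im / dt (ϖ (X i)) (ϖ (X n)), (ϖ (X i)).im / dt (ϖ (X i)) (ϖ (X n)),
      div_pos (by linarith) h3, div_nonneg h1 h3.le, ?_⟩
    have h3' := h3.ne'
    rw [map_add, map_smul, map_smul]
    apply Complex.ext
    · simp
      field_simp
      unfold dt; ring
    · simp
      field_simp
      ring
  have main : ∀ i n i' n' : I, n ∈ nb X i → (ϖ (X n)).im < 0 → 0 ≤ (ϖ (X i')).im →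
      ∀ a b a' b' c : ℝ, 0 < a' → 0 ≤ b' → 0 ≤ c →
      (a • X i + b • X n) - (a' • X i' + b' • X n') = c • o → i = i' := by
    intro i n i' n' hn hin hii a b a' b' c ha hb hc h
    obtain ⟨l, h1, h2⟩ := hn.2
    have hp := relInt_pos_of_face ho h1 h2 (pair_ne_univ (X := X) (by omega) _ _)
    have := congrArg l h
    simp only [map_add, map_sub, map_smul, smul_eq_mul, (h2 i).1 (by simp),
      (h2 n).1 (by simp)] at this
    have q1 := mul_nonneg hb (h1 n')
    have q2 := mul_nonneg hc hp.le
    have q3 : a' * l (X i') ≤ 0 := by linarith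
    have q4 : l (X i') = 0 := by
      apply le_antisymm _ (h1 i')
      by_contra hh
      push Not at hh
      nlinarith [mul_pos ha hh]
    rcases (h2 i').2 q4 with h | h
    · exact h.symm
    · rw [mem_singleton_iff] at h
      rw [h] at hii
      linarith
  obtain ⟨a, b, ha, hb, hab⟩ := rep i n h1 h2 h3
  obtain ⟨a', b', ha', hb', hab'⟩ := rep i' n' h1' h2' h3'
  have mem : ∀ (i n : I) (a b : ℝ), a • X i + b • X n ∈ Submodule.span ℝ (range X) := fun i n a b =>
    (Submodule.add_mem _ (Submodule.smul_mem _ _ (Submodule.subset_span ⟨i, rfl⟩))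
      (Submodule.smul_mem _ _ (Submodule.subset_span ⟨n, rfl⟩)))
  obtain ⟨c, hc⟩ := hk ((a • X i + b • X n) - (a' • X i' + b' • X n'))
    (Submodule.sub_mem _ (mem _ _ _ _) (mem _ _ _ _)) (by rw [map_sub, hab, hab', sub_self])
  rcases le_total 0 c with h | h
  · exact main i n i' n' hn h2 h1' a b a' b' c ha' hb' h hc
  · refine (main i' n' i n hn' h2' h1 a' b' a b (-c) ha hb (by linarith) ?_).symm
    rw [neg_smul, ← hc]; abel

open Classical in
/-- The angle sum around the centre. -/
lemma angle_sum [Fintype I] (hX : Good X) (hr : rk X = 3) (ho : RelInt X o) (ho0 : ϖ o = 0)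
    (hk : ∀ x ∈ Submodule.span ℝ (range X), ϖ x = 0 → ∃ t : ℝ, x = t • o) :
    ∑ i, ∑ j with j ∈ nb X i, InnerProductGeometry.angle (ϖ (X i)) (ϖ (X j)) = 4 * Real.pi := by
  choose n p hnp hnb hn hp using as_next hX hr ho ho0 hk
  have hnm : ∀ i, n i ∈ nb X i := fun i => by rw [hnb]; simp
  have hpm : ∀ i, p i ∈ nb X i := fun i => by rw [hnb]; simp
  have hnp' : ∀ i, p (n i) = i := by
    intro i
    have h1 : i ∈ nb X (n i) := nb_symm.1 (hnm i)
    rw [hnb] at h1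
    rcases h1 with h1 | h1
    · have := hn (n i)
      rw [← h1, dt_swap] at this
      linarith [hn i]
    · exact (mem_singleton_iff.1 h1).symm
  have hpn' : ∀ i, n (p i) = i := by
    intro i
    have h1 : i ∈ nb X (p i) := nb_symm.1 (hpm i)
    rw [hnb] at h1
    rcases h1 with h1 | h1
    · exact h1.symm
    · rw [mem_singleton_iff] at h1
      have := hp (p i)
      rw [← h1, dt_swap] at this
      linarith [hp i]
  let e : Equiv.Perm I := ⟨n, p, hnp', hpn'⟩
  have hsum : ∀ i, ∑ j with j ∈ nb X i, InnerProductGeometry.angle (ϖ (X i)) (ϖ (X j)) =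
      InnerProductGeometry.angle (ϖ (X i)) (ϖ (X (n i))) +
      InnerProductGeometry.angle (ϖ (X i)) (ϖ (X (p i))) := by
    intro i
    have : (Finset.univ.filter fun j => j ∈ nb X i) = {n i, p i} := by
      ext j; simp [hnb]
    rw [this, Finset.sum_pair (hnp i)]
  simp_rw [hsum]
  rw [Finset.sum_add_distrib]
  have h2 : ∑ i, InnerProductGeometry.angle (ϖ (X i)) (ϖ (X (p i))) =
      ∑ i, InnerProductGeometry.angle (ϖ (X i)) (ϖ (X (n i))) := by
    rw [← Equiv.sum_comp e]
    apply Finset.sum_congr rfl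
    intro i _
    rw [InnerProductGeometry.angle_comm]
    simp [e, hnp']
  rw [h2]
  set S := ∑ i, InnerProductGeometry.angle (ϖ (X i)) (ϖ (X (n i))) with hS
  let C : Finset I := Finset.univ.filter fun i =>
    InnerProductGeometry.angle (ϖ (X i)) (ϖ (X (n i))) ≠ (ϖ (X (n i))).arg - (ϖ (X i)).arg
  have hC : ∀ i ∈ C, InnerProductGeometry.angle (ϖ (X i)) (ϖ (X (n i))) =
      (ϖ (X (n i))).arg - (ϖ (X i)).arg + 2 * Real.pi ∧ 0 ≤ (ϖ (X i)).im ∧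
      (ϖ (X (n i))).im < 0 := by
    intro i hi
    have hi' := (Finset.mem_filter.1 hi).2
    rcases dt_pos_angle (hn i) with h | h
    · exact absurd h hi'
    · exact h
  have hS2 : S = C.card * (2 * Real.pi) := by
    have e1 : ∀ i, InnerProductGeometry.angle (ϖ (X i)) (ϖ (X (n i))) =
        ((ϖ (X (n i))).arg - (ϖ (X i)).arg) + if i ∈ C then 2 * Real.pi else 0 := by
      intro i
      split_ifs with hi
      · exact (hC i hi).1
      · by_contra hh
        rw [add_zero] at hh
        exact hi (Finset.mem_filter.2 ⟨Finset.mem_univ _, hh⟩)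
    rw [hS]
    simp_rw [e1]
    rw [Finset.sum_add_distrib, Finset.sum_sub_distrib]
    have e2 : ∑ i, (ϖ (X (n i))).arg = ∑ i, (ϖ (X i)).arg :=
      Equiv.sum_comp e (fun i => (ϖ (X i)).arg)
    rw [e2, sub_self, zero_add, ← Finset.sum_filter]
    simp
  have hcard1 : C.card ≤ 1 := by
    rw [Finset.card_le_one]
    intro a ha b hb
    have := hC a ha
    have := hC b hb
    apply as_cross hr ho hk (hnm a) (hnm b) <;> first | tauto | apply hn
  have hne : Nonempty I := by
    by_contra hI
    rw [not_nonempty_iff] at hI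
    rw [rk_empty] at hr
    omega
  have hpos : 0 < S := by
    apply Finset.sum_pos
    · intro i _
      have hh := hn i
      refine lt_of_le_of_ne (InnerProductGeometry.angle_nonneg _ _) ?_
      intro h0
      have h0' := h0.symm
      rw [InnerProductGeometry.angle_eq_zero_iff] at h0'
      obtain ⟨-, r, -, hr'⟩ := h0'
      rw [hr'] at hh
      unfold dt at hh
      simp at hh
      linarith [hh]
    · exact Finset.univ_nonempty
  have hcard : C.card = 1 := by
    have : C.card ≠ 0 := by
      intro h0
      rw [hS2, h0] at hpos
      simp at hpos
    omega
  rw [hS2, hcard]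
  push_cast
  ring

end AS
end ISim

namespace ISim
namespace Calc

lemma arcd {Ni Nj M : ℝ → ℝ} {ni nj m s : ℝ} (hi : HasDerivAt Ni ni s) (hj : HasDerivAt Nj nj s)
    (hm : HasDerivAt M m s) (pi : 0 < Ni s) (pj : 0 < Nj s) (hS : 0 < Ni s * Nj s - M s ^ 2) :
    HasDerivAt (fun s => Real.arccos (M s / √(Ni s * Nj s)))
      (-(m - M s * (ni * Nj s + Ni s * nj) / (2 * (Ni s * Nj s))) / √(Ni s * Nj s - M s ^ 2)) s := by
  have hP : 0 < Ni s * Nj s := mul_pos pi pj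
  have hq : 0 < √(Ni s * Nj s) := Real.sqrt_pos.2 hP
  have hq2 : √(Ni s * Nj s) ^ 2 = Ni s * Nj s := Real.sq_sqrt hP.le
  have ht : 0 < √(Ni s * Nj s - M s ^ 2) := Real.sqrt_pos.2 hS
  have hR2 : 1 - (M s / √(Ni s * Nj s)) ^ 2 = (Ni s * Nj s - M s ^ 2) / (Ni s * Nj s) := by
    rw [div_pow, hq2]; field_simp
  have hRpos : 0 < 1 - (M s / √(Ni s * Nj s)) ^ 2 := by rw [hR2]; positivity
  have hd := ((hm.div ((hi.mul hj).sqrt hP.ne') hq.ne'))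
  have ha := Real.hasDerivAt_arccos (x := M s / √(Ni s * Nj s))
    (by intro h; rw [h] at hRpos; norm_num at hRpos) (by intro h; rw [h] at hRpos; norm_num at hRpos)
  have := ha.comp s hd
  refine this.congr_deriv ?_
  rw [hR2, Real.sqrt_div' _ hP.le]
  simp only [Pi.mul_apply]
  have e : Ni s * Nj s = √(Ni s * Nj s) ^ 2 := hq2.symm
  generalize √(Ni s * Nj s - M s ^ 2) = t at *
  generalize √(Ni s * Nj s) = q at *
  rw [e]
  field_simp

lemma ratio_pos {a a' b b' N : ℝ} (h : 0 < a + a') (hb : 0 < b) (hb' : 0 < b')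
    (h1 : a ^ 2 + b ^ 2 = N) (h2 : a' ^ 2 + b' ^ 2 = N) : 0 < a / b + a' / b' := by
  have key : 0 < a * b' + a' * b := by
    rcases le_total 0 a with ha | ha <;> rcases le_total 0 a' with ha' | ha'
    · rcases lt_or_eq_of_le ha with h3 | h3
      · have := mul_pos h3 hb'
        have := mul_nonneg ha' hb.le
        linarith
      · have : 0 < a' := by linarith
        have := mul_pos this hb
        rw [← h3]; linarith
    · have : b < b' := by
        by_contra hh; push Not at hh
        nlinarith
      nlinarith
    · have : b' < b := by
        by_contra hh; push Not at hh
        nlinarith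
      nlinarith
    · linarith
  rw [div_add_div _ _ hb.ne' hb'.ne']
  apply div_pos
  · linarith
  · positivity

variable {I : Type*}

def N (α κ : ℝ) (k : I → I → ℝ) (y : I → ℝ) (i : I) : ℝ := k i i - 2 * α * y i - κ * y i ^ 2
def M (α κ : ℝ) (k : I → I → ℝ) (y : I → ℝ) (i j : I) : ℝ :=
  k i j - α * (y i + y j) - κ * (y i * y j)
def S2 (α κ : ℝ) (k : I → I → ℝ) (y : I → ℝ) (i j : I) : ℝ :=
  N α κ k y i * N α κ k y j - M α κ k y i j ^ 2
def cc (α κ : ℝ) (k : I → I → ℝ) (y : I → ℝ) (i j : I) : ℝ :=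
  α * (k i i - k i j) + y j * (α ^ 2 + κ * k i i) - y i * (α ^ 2 + κ * k i j)
def L2 (α κ : ℝ) (k : I → I → ℝ) (i j : I) : ℝ :=
  α ^ 2 * (k i i + k j j - 2 * k i j) + κ * (k i i * k j j - k i j ^ 2)

lemma ident (α κ : ℝ) (k : I → I → ℝ) (y : I → ℝ) (i j : I) :
    cc α κ k y i j ^ 2 + (α ^ 2 + κ * k i i) * S2 α κ k y i j = L2 α κ k i j * N α κ k y i := by
  unfold cc S2 L2 M N; ring

structure Adm (α κ : ℝ) (k : I → I → ℝ) (nf : I → Finset I) (y : I → ℝ) : Prop where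
  hN : ∀ i, 0 < N α κ k y i
  hS : ∀ i, ∀ j ∈ nf i, 0 < S2 α κ k y i j
  hE : ∀ i, 0 < ∑ j ∈ nf i, cc α κ k y i j / √(L2 α κ k i j)

lemma Adm.L2pos {α κ : ℝ} {k : I → I → ℝ} {nf : I → Finset I} {y : I → ℝ}
    (h : Adm α κ k nf y) (hw : ∀ i, 0 < α ^ 2 + κ * k i i) {i j : I} (hj : j ∈ nf i) :
    0 < L2 α κ k i j := by
  have := ident α κ k y i j
  have h1 := mul_pos (hw i) (h.hS i j hj)
  have h2 := h.hN i
  by_contra hh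
  push Not at hh
  nlinarith [sq_nonneg (cc α κ k y i j), mul_nonneg (neg_nonneg.2 hh) h2.le]

lemma Adm.path {α κ : ℝ} (hκ : 0 ≤ κ) {k : I → I → ℝ} {nf : I → Finset I} {y z : I → ℝ}
    (hw : ∀ i, 0 < α ^ 2 + κ * k i i)
    (hy : Adm α κ k nf y) (hz : Adm α κ k nf z) {s : ℝ} (h0 : 0 ≤ s) (h1 : s ≤ 1) :
    Adm α κ k nf (fun i => y i + s * (z i - y i)) := by
  have hcomb : ∀ a b : ℝ, 0 < a → 0 < b → 0 < (1 - s) * a + s * b := by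
    intro a b ha hb
    rcases eq_or_lt_of_le h0 with h | h
    · rw [← h]; simpa
    · have := mul_pos h hb
      have := mul_nonneg (sub_nonneg.2 h1) ha.le
      linarith
  have hss : 0 ≤ s * (1 - s) := mul_nonneg h0 (by linarith)
  have hNc : ∀ i, (1 - s) * N α κ k y i + s * N α κ k z i ≤
      N α κ k (fun i => y i + s * (z i - y i)) i := by
    intro i
    have : N α κ k (fun i => y i + s * (z i - y i)) i - ((1 - s) * N α κ k y i + s * N α κ k z i)
      = κ * ((s * (1 - s)) * (z i - y i) ^ 2) := by unfold N; ring
    have h2 : 0 ≤ κ * ((s * (1 - s)) * (z i - y i) ^ 2) := by positivity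
    linarith
  have hca : ∀ i j, cc α κ k (fun i => y i + s * (z i - y i)) i j =
      (1 - s) * cc α κ k y i j + s * cc α κ k z i j := by
    intro i j; unfold cc; ring
  refine ⟨fun i => lt_of_lt_of_le (hcomb _ _ (hy.hN i) (hz.hN i)) (hNc i), ?_, ?_⟩
  · intro i j hj
    have hL := hy.L2pos hw hj
    have e1 := ident α κ k y i j
    have e2 := ident α κ k z i j
    have e3 := ident α κ k (fun i => y i + s * (z i - y i)) i j
    rw [hca] at e3
    have e4 := mul_le_mul_of_nonneg_left (hNc i) hL.le
    have e5 := hcomb _ _ (mul_pos (hw i) (hy.hS i j hj)) (mul_pos (hw i) (hz.hS i j hj))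
    have e6 : 0 < (α ^ 2 + κ * k i i) * S2 α κ k (fun i => y i + s * (z i - y i)) i j := by
      have e7 : 0 ≤ (s * (1 - s)) * (cc α κ k y i j - cc α κ k z i j) ^ 2 := by positivity
      have e8 : (1 - s) * (L2 α κ k i j * N α κ k y i) + s * (L2 α κ k i j * N α κ k z i) ≤
        L2 α κ k i j * N α κ k (fun i => y i + s * (z i - y i)) i := by linarith
      rw [← e1, ← e2, ← e3] at e8
      nlinarith
    exact pos_of_mul_pos_right e6 (hw i).le
  · intro i
    have : ∑ j ∈ nf i, cc α κ k (fun i => y i + s * (z i - y i)) i j / √(L2 α κ k i j) =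
      (1 - s) * ∑ j ∈ nf i, cc α κ k y i j / √(L2 α κ k i j) +
        s * ∑ j ∈ nf i, cc α κ k z i j / √(L2 α κ k i j) := by
      rw [Finset.mul_sum, Finset.mul_sum, ← Finset.sum_add_distrib]
      apply Finset.sum_congr rfl
      intro j _
      rw [hca]; ring
    rw [this]
    exact hcomb _ _ (hy.hE i) (hz.hE i)

lemma Adm.sum_pos {α κ : ℝ} {k : I → I → ℝ} {nf : I → Finset I} {y : I → ℝ}
    (hw : ∀ i, 0 < α ^ 2 + κ * k i i) (hnf : ∀ i, ∃ j l, j ≠ l ∧ ∀ a, a ∈ nf i ↔ a = j ∨ a = l)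
    (hy : Adm α κ k nf y) (i : I) : 0 < ∑ j ∈ nf i, cc α κ k y i j / √(S2 α κ k y i j) := by
  classical
  obtain ⟨j, l, hjl, h⟩ := hnf i
  have hset : nf i = {j, l} := by ext a; simp [h]
  have hj : j ∈ nf i := by simp [hset]
  have hl : l ∈ nf i := by simp [hset]
  have hE := hy.hE i
  rw [hset, Finset.sum_pair hjl] at hE ⊢
  have hsw : 0 < √(α ^ 2 + κ * k i i) := Real.sqrt_pos.2 (hw i)
  have hsq : √(α ^ 2 + κ * k i i) ^ 2 = α ^ 2 + κ * k i i := Real.sq_sqrt (hw i).le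
  have aux : ∀ j ∈ nf i, 0 < √(L2 α κ k i j) ∧ 0 < √(S2 α κ k y i j) ∧
      (cc α κ k y i j / √(L2 α κ k i j)) ^ 2 +
        (√(α ^ 2 + κ * k i i) * √(S2 α κ k y i j) / √(L2 α κ k i j)) ^ 2 = N α κ k y i := by
    intro j hj
    have h1 := hy.L2pos hw hj
    have h2 := hy.hS i j hj
    refine ⟨Real.sqrt_pos.2 h1, Real.sqrt_pos.2 h2, ?_⟩
    rw [div_pow, div_pow, mul_pow, hsq, Real.sq_sqrt h1.le, Real.sq_sqrt h2.le, ← add_div,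
      ident]
    field_simp
  obtain ⟨p1, p2, p3⟩ := aux j hj
  obtain ⟨q1, q2, q3⟩ := aux l hl
  have := ratio_pos hE (by positivity) (by positivity) p3 q3
  have e : ∀ c L S : ℝ, 0 < L → 0 < S → c / L / (√(α ^ 2 + κ * k i i) * S / L) =
      (c / S) / √(α ^ 2 + κ * k i i) := by
    intro c L S hL hS
    field_simp
  rw [e _ _ _ p1 p2, e _ _ _ q1 q2, ← add_div] at this
  by_contra hh
  push Not at hh
  exact absurd this (not_lt.2 (div_nonpos_of_nonpos_of_nonneg hh hsw.le))

lemma main [Fintype I] {α κ : ℝ} (hκ : 0 ≤ κ) {k : I → I → ℝ}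
    {nf : I → Finset I} {y z : I → ℝ}
    (hk : ∀ i j, k i j = k j i) (hsymm : ∀ i j, j ∈ nf i ↔ i ∈ nf j)
    (hw : ∀ i, 0 < α ^ 2 + κ * k i i)
    (hnf : ∀ i, ∃ j l, j ≠ l ∧ ∀ a, a ∈ nf i ↔ a = j ∨ a = l)
    (hy : Adm α κ k nf y) (hz : Adm α κ k nf z) (hle : ∀ i, y i ≤ z i)
    (hΨ : ∑ i, ∑ j ∈ nf i, Real.arccos (M α κ k y i j / √(N α κ k y i * N α κ k y j)) =
      ∑ i, ∑ j ∈ nf i, Real.arccos (M α κ k z i j / √(N α κ k z i * N α κ k z j))) :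
    ∀ i, y i = z i := by
  by_contra hne
  push Not at hne
  obtain ⟨i0, hi0⟩ := hne
  let p : ℝ → I → ℝ := fun s i => y i + s * (z i - y i)
  let Ψ : ℝ → ℝ := fun s => ∑ i, ∑ j ∈ nf i,
    Real.arccos (M α κ k (p s) i j / √(N α κ k (p s) i * N α κ k (p s) j))
  have hadm : ∀ s ∈ Icc (0:ℝ) 1, Adm α κ k nf (p s) := fun s hs => hy.path hκ hw hz hs.1 hs.2
  let D : ℝ → ℝ := fun s => ∑ i, ∑ j ∈ nf i,
    ((z i - y i) * (cc α κ k (p s) i j / (N α κ k (p s) i * √(S2 α κ k (p s) i j))) +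
     (z j - y j) * (cc α κ k (p s) j i / (N α κ k (p s) j * √(S2 α κ k (p s) j i))))
  have hp : ∀ s i, HasDerivAt (fun s => p s i) (z i - y i) s := by
    intro s i
    have := ((hasDerivAt_id s).mul_const (z i - y i)).const_add (y i)
    simpa [p] using this
  have hderiv : ∀ s ∈ Icc (0:ℝ) 1, HasDerivAt Ψ (D s) s := by
    intro s hs
    refine HasDerivAt.fun_sum fun i _ => HasDerivAt.fun_sum fun j hj => ?_
    have hA := hadm s hs
    have dN : ∀ i, HasDerivAt (fun s => N α κ k (p s) i)
        (-(2 * (α + κ * p s i) * (z i - y i))) s := by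
      intro i
      have := ((hp s i).const_mul (2 * α)).const_sub (k i i) |>.sub
        (((hp s i).pow 2).const_mul κ)
      refine this.congr_deriv ?_
      ring
    have dM : HasDerivAt (fun s => M α κ k (p s) i j)
        (-((α + κ * p s j) * (z i - y i) + (α + κ * p s i) * (z j - y j))) s := by
      have := (((hp s i).add (hp s j)).const_mul α).const_sub (k i j) |>.sub
        (((hp s i).mul (hp s j)).const_mul κ)
      refine this.congr_deriv ?_
      ring
    have := arcd (dN i) (dN j) dM (hA.hN i) (hA.hN j) (hA.hS i j hj)
    refine this.congr_deriv ?_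
    have hSs : S2 α κ k (p s) j i = S2 α κ k (p s) i j := by
      unfold S2 M; rw [hk j i]; ring
    have hSe : N α κ k (p s) i * N α κ k (p s) j - M α κ k (p s) i j ^ 2 = S2 α κ k (p s) i j := rfl
    have hcij : cc α κ k (p s) i j = (α + κ * p s j) * N α κ k (p s) i -
        (α + κ * p s i) * M α κ k (p s) i j := by unfold cc N M; ring
    have hcji : cc α κ k (p s) j i = (α + κ * p s i) * N α κ k (p s) j -
        (α + κ * p s j) * M α κ k (p s) i j := by unfold cc N M; rw [hk j i]; ring
    rw [hSs, hSe, hcij, hcji]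
    have h1 := hA.hN i
    have h2 := hA.hN j
    have h3 : 0 < √(S2 α κ k (p s) i j) := Real.sqrt_pos.2 (hA.hS i j hj)
    generalize √(S2 α κ k (p s) i j) = S at *
    generalize M α κ k (p s) i j = m at *
    generalize N α κ k (p s) i = n1 at *
    generalize N α κ k (p s) j = n2 at *
    field_simp
    ring
  have hDpos : ∀ s ∈ Icc (0:ℝ) 1, 0 < D s := by
    intro s hs
    have hA := hadm s hs
    have hD : D s = 2 * ∑ i, ((z i - y i) / N α κ k (p s) i) *
        ∑ j ∈ nf i, cc α κ k (p s) i j / √(S2 α κ k (p s) i j) := by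
      simp only [D, Finset.sum_add_distrib]
      have hsw : ∑ i, ∑ j ∈ nf i, (z j - y j) *
          (cc α κ k (p s) j i / (N α κ k (p s) j * √(S2 α κ k (p s) j i))) =
          ∑ i, ∑ j ∈ nf i, (z i - y i) *
          (cc α κ k (p s) i j / (N α κ k (p s) i * √(S2 α κ k (p s) i j))) := by
        apply Finset.sum_comm'
        intro a b
        simp [hsymm]
      rw [hsw, ← two_mul]
      congr 1
      apply Finset.sum_congr rfl
      intro i _
      rw [Finset.mul_sum]
      apply Finset.sum_congr rfl
      intro j _
      rw [div_mul_div_comm, mul_div_assoc]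
    rw [hD]
    apply mul_pos two_pos
    apply Finset.sum_pos'
    · intro i _
      exact mul_nonneg (div_nonneg (by linarith [hle i]) (hA.hN i).le) (hA.sum_pos hw hnf i).le
    · refine ⟨i0, Finset.mem_univ _, mul_pos (div_pos ?_ (hA.hN i0)) (hA.sum_pos hw hnf i0)⟩
      have := lt_of_le_of_ne (hle i0) hi0
      linarith
  have hmono : StrictMonoOn Ψ (Icc 0 1) := by
    apply strictMonoOn_of_deriv_pos (convex_Icc 0 1)
    · intro s hs; exact (hderiv s hs).continuousAt.continuousWithinAt
    · intro s hs
      rw [interior_Icc] at hs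
      have hs' : s ∈ Icc (0:ℝ) 1 := ⟨hs.1.le, hs.2.le⟩
      rw [(hderiv s hs').deriv]
      exact hDpos s hs'
  have := hmono (left_mem_Icc.2 zero_le_one) (right_mem_Icc.2 zero_le_one) zero_lt_one
  have e0 : p 0 = y := by funext i; simp [p]
  have e1 : p 1 = z := by funext i; simp [p]
  simp only [Ψ, e0, e1] at this
  linarith

end Calc
end ISim

namespace ISim

open scoped InnerProductSpace

section Nf

variable {V : Type*} [AddCommGroup V] [Module ℝ V] {I : Type*}

open Classical in
/-- neighbour finset -/
noncomputable def nf [Fintype I] (X : I → V) (i : I) : Finset I := Finset.univ.filter (· ∈ nb X i)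

lemma mem_nf [Fintype I] {X : I → V} {i j : I} : j ∈ nf X i ↔ j ∈ nb X i := by
  classical
  simp [nf]

lemma nf_pair [Fintype I] {X : I → V} (hX : Good X) (hr : rk X = 3) (i : I) :
    ∃ j l, j ≠ l ∧ ∀ a, a ∈ nf X i ↔ a = j ∨ a = l := by
  obtain ⟨j, l, hjl, h⟩ := hX.rk_three hr i
  exact ⟨j, l, hjl, fun a => by rw [mem_nf, h]; simp⟩

end Nf

section Base

variable {V : Type*} [NormedAddCommGroup V] [InnerProductSpace ℝ V]
variable {I : Type*}

lemma toC (S : Submodule ℝ V) [FiniteDimensional ℝ S] (h : Module.finrank ℝ S = 2) :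
    ∃ J : V →ₗ[ℝ] ℂ, ∀ x ∈ S, ∀ y ∈ S, ⟪J x, J y⟫_ℝ = ⟪x, y⟫_ℝ := by
  let e : S ≃ₗᵢ[ℝ] ℂ :=
    ((stdOrthonormalBasis ℝ S).reindex (finCongr h)).equiv Complex.orthonormalBasisOneI
      (Equiv.refl _)
  refine ⟨e.toLinearEquiv.toLinearMap.comp S.orthogonalProjectionOnto.toLinearMap, ?_⟩
  intro x hx y hy
  have h1 := Submodule.orthogonalProjectionOnto_mem_subspace_eq_self (⟨x, hx⟩ : S)
  have h2 := Submodule.orthogonalProjectionOnto_mem_subspace_eq_self (⟨y, hy⟩ : S)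
  simp only [] at h1 h2
  have : ⟪e (S.orthogonalProjectionOnto x), e (S.orthogonalProjectionOnto y)⟫_ℝ = ⟪x, y⟫_ℝ := by
    rw [h1, h2, e.inner_map_map]; rfl
  exact this

lemma planeMap [Finite I] {X : I → V} {o : V} (hr : rk X = 3)
    (ho : o ∈ Submodule.span ℝ (range X)) (ho0 : o ≠ 0) {T : V →ₗ[ℝ] V} (hT : T o = 0)
    (hk : ∀ x ∈ Submodule.span ℝ (range X), T x = 0 → ∃ t : ℝ, x = t • o) :
    ∃ ϖ : V →ₗ[ℝ] ℂ, ϖ o = 0 ∧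
      (∀ x ∈ Submodule.span ℝ (range X), ϖ x = 0 → ∃ t : ℝ, x = t • o) ∧
      ∀ i j, ⟪ϖ (X i), ϖ (X j)⟫_ℝ = ⟪T (X i), T (X j)⟫_ℝ := by
  have hfin : FiniteDimensional ℝ (Submodule.span ℝ (range X)) :=
    FiniteDimensional.span_of_finite ℝ (finite_range X)
  have h1 := LinearMap.finrank_range_add_finrank_ker (T.domRestrict (Submodule.span ℝ (range X)))
  rw [LinearMap.range_domRestrict] at h1
  have h2 : Module.finrank ℝ (LinearMap.ker (T.domRestrict (Submodule.span ℝ (range X)))) = 1 := by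
    rw [finrank_eq_one_iff_of_nonzero' (⟨⟨o, ho⟩, by simp [hT]⟩)]
    · rintro ⟨⟨x, hx⟩, hx'⟩
      simp at hx'
      obtain ⟨t, ht⟩ := hk x hx hx'
      exact ⟨t, by simp [ht]⟩
    · simp [Subtype.ext_iff, ho0]
  have h3 : Module.finrank ℝ ((Submodule.span ℝ (range X)).map T) = 2 := by
    unfold rk at hr; omega
  obtain ⟨J, hJ⟩ := toC ((Submodule.span ℝ (range X)).map T) h3
  have hm : ∀ x ∈ Submodule.span ℝ (range X), T x ∈ (Submodule.span ℝ (range X)).map T :=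
    fun x hx => Submodule.mem_map_of_mem hx
  refine ⟨J.comp T, by simp [hT], ?_, ?_⟩
  · intro x hx h0
    apply hk x hx
    have := hJ _ (hm x hx) _ (hm x hx)
    simp only [LinearMap.comp_apply] at h0
    rw [h0, inner_zero_left] at this
    exact inner_self_eq_zero.1 this.symm
  · intro i j
    exact hJ _ (hm _ (Submodule.subset_span ⟨i, rfl⟩)) _ (hm _ (Submodule.subset_span ⟨j, rfl⟩))

lemma Epos [Finite I] {X : I → V} (hX : Good X) (hr : rk X = 3) {o : V} (ho : RelInt X o)
    {i j l : I} (hjl : j ≠ l) (hn : nb X i = {j, l}) {π : V →ₗ[ℝ] V} (hπ : LinkMap X i π) :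
    0 < ⟪π (X j), π o⟫_ℝ / ‖π (X j)‖ + ⟪π (X l), π o⟫_ℝ / ‖π (X l)‖ := by
  have hj : j ∈ nb X i := by rw [hn]; simp
  have hl : l ∈ nb X i := by rw [hn]; simp
  obtain ⟨a, b, c, ha, hb, hoe⟩ := relInt_rep hX hr ho hjl hn
  have hG := hπ.good hX
  have hj0 : π (X j) ≠ 0 := hG.ne_zero ⟨j, hj⟩
  have hl0 : π (X l) ≠ 0 := hG.ne_zero ⟨l, hl⟩
  obtain ⟨m, hm⟩ := hG.posfun
  have mj : 0 < m (π (X j)) := hm ⟨j, hj⟩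
  have ml : 0 < m (π (X l)) := hm ⟨l, hl⟩
  have hπo : π o = a • π (X j) + b • π (X l) := by rw [hoe]; simp [hπ.zero]
  rw [hπo]
  set z := π (X j)
  set w := π (X l)
  have nz : 0 < ‖z‖ := norm_pos_iff.2 hj0
  have nw : 0 < ‖w‖ := norm_pos_iff.2 hl0
  have hgt : 0 < ‖z‖ * ‖w‖ + ⟪z, w⟫_ℝ := by
    have hne : ‖w‖ • z + ‖z‖ • w ≠ 0 := by
      intro h0
      have := congrArg m h0
      simp only [map_add, map_smul, smul_eq_mul, map_zero] at this
      nlinarith [mul_pos nw mj, mul_pos nz ml]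
    have h2 : 0 < ‖‖w‖ • z + ‖z‖ • w‖ ^ 2 := by positivity
    rw [← real_inner_self_eq_norm_sq] at h2
    simp only [inner_add_left, inner_add_right, real_inner_smul_left, real_inner_smul_right,
      real_inner_self_eq_norm_sq, norm_smul, norm_norm] at h2
    have h3 : 0 < 2 * (‖z‖ * ‖w‖) * (‖z‖ * ‖w‖ + ⟪z, w⟫_ℝ) := by
      have e := real_inner_comm z w
      rw [e] at h2
      linear_combination h2
    exact pos_of_mul_pos_right h3 (by positivity)
  simp only [inner_add_right, real_inner_smul_right, real_inner_self_eq_norm_sq, real_inner_comm z w]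
  have e := real_inner_comm z w
  rw [div_add_div _ _ nz.ne' nw.ne']
  apply div_pos _ (mul_pos nz nw)
  have : (a * ‖z‖ ^ 2 + b * ⟪z, w⟫_ℝ) * ‖w‖ + ‖z‖ * (a * ⟪z, w⟫_ℝ + b * ‖w‖ ^ 2) =
    (a * ‖z‖ + b * ‖w‖) * (‖z‖ * ‖w‖ + ⟪z, w⟫_ℝ) := by ring
  have h4 : 0 < (a * ‖z‖ + b * ‖w‖) * (‖z‖ * ‖w‖ + ⟪z, w⟫_ℝ) := by positivity
  nlinarith [this, h4, e]

lemma angle_sum' [Fintype I] {X : I → V} {o : V} {ϖ : V →ₗ[ℝ] ℂ} (hX : Good X) (hr : rk X = 3)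
    (ho : RelInt X o) (ho0 : ϖ o = 0)
    (hk : ∀ x ∈ Submodule.span ℝ (range X), ϖ x = 0 → ∃ t : ℝ, x = t • o) :
    ∑ i, ∑ j ∈ nf X i, InnerProductGeometry.angle (ϖ (X i)) (ϖ (X j)) = 4 * Real.pi := by
  rw [← angle_sum hX hr ho ho0 hk]
  rfl

lemma RelInt.ne_zero [Finite I] {X : I → V} {o : V} (hX : Good X) (hr : 1 ≤ rk X) (ho : RelInt X o) :
    o ≠ 0 := by
  rintro rfl
  obtain ⟨l, hl⟩ := hX.posfun
  have hne : Nonempty I := by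
    by_contra hI
    rw [not_nonempty_iff] at hI
    rw [rk_empty] at hr
    omega
  obtain ⟨i⟩ := hne
  have := ho.pos l (fun i => (hl i).le) ⟨i, (hl i).ne'⟩
  simp at this

lemma base_adm [Fintype I] {X : I → V} {o : V} (hX : Good X) (hr : rk X = 3) (ho : RelInt X o)
    {T : V →ₗ[ℝ] V} (hT : T o = 0)
    (hk : ∀ x ∈ Submodule.span ℝ (range X), T x = 0 → ∃ t : ℝ, x = t • o)
    {α κ : ℝ} {k : I → I → ℝ} {y : I → ℝ}
    (hM : ∀ i j, (j = i ∨ j ∈ nb X i) → ⟪T (X i), T (X j)⟫_ℝ = Calc.M α κ k y i j)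
    (hE : ∀ i, 0 < ∑ j ∈ nf X i, Calc.cc α κ k y i j / √(Calc.L2 α κ k i j)) :
    Calc.Adm α κ k (nf X) y ∧ ∑ i, ∑ j ∈ nf X i,
      Real.arccos (Calc.M α κ k y i j / √(Calc.N α κ k y i * Calc.N α κ k y j)) = 4 * Real.pi := by
  obtain ⟨ϖ, h1, h2, h3⟩ := planeMap hr ho.mem (ho.ne_zero hX (by omega)) hT hk
  have hMN : ∀ i, Calc.M α κ k y i i = Calc.N α κ k y i := by
    intro i; unfold Calc.M Calc.N; ring
  have hN : ∀ i, ‖ϖ (X i)‖ ^ 2 = Calc.N α κ k y i := by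
    intro i
    rw [← real_inner_self_eq_norm_sq, h3, hM i i (Or.inl rfl), hMN]
  have hn0 : ∀ i, ϖ (X i) ≠ 0 := as_ne_zero hX hr ho h2
  refine ⟨⟨?_, ?_, hE⟩, ?_⟩
  · intro i
    rw [← hN]
    have := norm_pos_iff.2 (hn0 i)
    positivity
  · intro i j hj
    rw [mem_nf] at hj
    unfold Calc.S2
    rw [← hN, ← hN, ← hM i j (Or.inr hj), ← h3]
    have hd := as_dt_ne_zero hX hr ho h2 hj
    have : ‖ϖ (X i)‖ ^ 2 * ‖ϖ (X j)‖ ^ 2 - ⟪ϖ (X i), ϖ (X j)⟫_ℝ ^ 2 = dt (ϖ (X i)) (ϖ (X j)) ^ 2 := by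
      rw [← Complex.normSq_eq_norm_sq, ← Complex.normSq_eq_norm_sq, Complex.inner]
      simp [Complex.normSq_apply, dt]
      ring
    rw [this]
    positivity
  · rw [← angle_sum' hX hr ho h1 h2]
    apply Finset.sum_congr rfl
    intro i _
    apply Finset.sum_congr rfl
    intro j hj
    rw [mem_nf] at hj
    unfold InnerProductGeometry.angle
    rw [h3, hM i j (Or.inr hj), ← hN, ← hN, Real.sqrt_mul (by positivity),
      Real.sqrt_sq (norm_nonneg _), Real.sqrt_sq (norm_nonneg _)]

/-- link projection in the spherical setting -/
noncomputable def sphπ (v : V) : V →ₗ[ℝ] V := LinearMap.id - (‖v‖ ^ 2)⁻¹ • (innerₗ V v).smulRight v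

lemma sphπ_apply (v x : V) : sphπ v x = x - (⟪v, x⟫_ℝ / ‖v‖ ^ 2) • v := by
  simp [sphπ, smul_smul, div_eq_inv_mul]

lemma sphπ_self (v : V) : sphπ v v = 0 := by
  rw [sphπ_apply, real_inner_self_eq_norm_sq]
  by_cases h : v = 0
  · simp [h]
  · have : ‖v‖ ≠ 0 := norm_ne_zero_iff.2 h
    rw [div_self (by positivity), one_smul, sub_self]

lemma sphπ_ker (v x : V) (h : sphπ v x = 0) : ∃ t : ℝ, x = t • v := by
  rw [sphπ_apply, sub_eq_zero] at h
  exact ⟨_, h⟩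

lemma sphπ_inner (v x y : V) (hv : v ≠ 0) :
    ⟪sphπ v x, sphπ v y⟫_ℝ = ⟪x, y⟫_ℝ - ⟪v, x⟫_ℝ * ⟪v, y⟫_ℝ / ‖v‖ ^ 2 := by
  have : ‖v‖ ≠ 0 := norm_ne_zero_iff.2 hv
  rw [sphπ_apply, sphπ_apply]
  simp only [inner_sub_left, inner_sub_right, real_inner_smul_left, real_inner_smul_right,
    real_inner_self_eq_norm_sq, real_inner_comm v x]
  rw [real_inner_comm x v]
  field_simp
  ring

lemma sphπ_link (X : I → V) (i : I) : LinkMap X i (sphπ (X i)) :=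
  ⟨sphπ_self _, fun x hx => sphπ_ker _ x hx⟩

lemma sph_E [Fintype I] {X : I → V} (hX : Good X) (hr : rk X = 3) {o : V} (ho : RelInt X o)
    {k : I → I → ℝ} (hk : ∀ i j, (j = i ∨ j ∈ nb X i) → ⟪X i, X j⟫_ℝ = k i j)
    (hkk : ∀ i j, k i j = k j i) {κ : ℝ} (hκ : 0 < κ) (i : I) :
    0 < ∑ j ∈ nf X i, Calc.cc 0 κ k (fun i => ⟪X i, o⟫_ℝ) i j / √(Calc.L2 0 κ k i j) := by
  classical
  obtain ⟨j, l, hjl, hn⟩ := hX.rk_three hr i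
  have hset : nf X i = {j, l} := by ext a; rw [mem_nf, hn]; simp
  rw [hset, Finset.sum_pair hjl]
  have hE := Epos hX hr ho hjl hn (sphπ_link X i)
  have hki : k i i = ‖X i‖ ^ 2 := by rw [← hk i i (Or.inl rfl), real_inner_self_eq_norm_sq]
  have hi0 := hX.ne_zero i
  have hnp : 0 < ‖X i‖ := norm_pos_iff.2 hi0
  have key : ∀ j ∈ nb X i, Calc.cc 0 κ k (fun i => ⟪X i, o⟫_ℝ) i j / √(Calc.L2 0 κ k i j) =
      √(κ * k i i) * (⟪sphπ (X i) (X j), sphπ (X i) o⟫_ℝ / ‖sphπ (X i) (X j)‖) := by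
    intro j hj
    have hZ : sphπ (X i) (X j) ≠ 0 := ((sphπ_link X i).good hX).ne_zero ⟨j, hj⟩
    have hkj : k j j = ‖X j‖ ^ 2 := by rw [← hk j j (Or.inl rfl), real_inner_self_eq_norm_sq]
    have hkij : ⟪X i, X j⟫_ℝ = k i j := hk i j (Or.inr hj)
    have e1 : Calc.L2 0 κ k i j = (κ * k i i) * ‖sphπ (X i) (X j)‖ ^ 2 := by
      rw [← real_inner_self_eq_norm_sq, sphπ_inner _ _ _ hi0, real_inner_self_eq_norm_sq, hkij,
        ← hkj, ← hki]
      have : k i i ≠ 0 := by rw [hki]; positivity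
      unfold Calc.L2
      field_simp
      ring
    have e2 : Calc.cc 0 κ k (fun i => ⟪X i, o⟫_ℝ) i j =
        (κ * k i i) * ⟪sphπ (X i) (X j), sphπ (X i) o⟫_ℝ := by
      rw [sphπ_inner _ _ _ hi0, hkij, ← hki]
      have : k i i ≠ 0 := by rw [hki]; positivity
      unfold Calc.cc
      field_simp
      ring
    have hp : 0 < κ * k i i := by rw [hki]; positivity
    have hs := Real.sqrt_pos.2 hp
    have hnz : 0 < ‖sphπ (X i) (X j)‖ := norm_pos_iff.2 hZ
    rw [e1, e2, Real.sqrt_mul hp.le, Real.sqrt_sq hnz.le]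
    nth_rewrite 1 [← Real.mul_self_sqrt hp.le]
    field_simp
  rw [key j (by rw [hn]; simp), key l (by rw [hn]; simp), ← mul_add]
  have hp : 0 < κ * k i i := by rw [hki]; positivity
  exact mul_pos (Real.sqrt_pos.2 hp) hE

lemma sph_adm [Fintype I] {X : I → V} (hX : Good X) (hr : rk X = 3) {o : V} (ho : RelInt X o)
    {k : I → I → ℝ} (hk : ∀ i j, (j = i ∨ j ∈ nb X i) → ⟪X i, X j⟫_ℝ = k i j)
    (hkk : ∀ i j, k i j = k j i) :
    Calc.Adm 0 ((‖o‖ ^ 2)⁻¹) k (nf X) (fun i => ⟪X i, o⟫_ℝ) ∧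
    ∑ i, ∑ j ∈ nf X i, Real.arccos (Calc.M 0 ((‖o‖ ^ 2)⁻¹) k (fun i => ⟪X i, o⟫_ℝ) i j /
      √(Calc.N 0 ((‖o‖ ^ 2)⁻¹) k (fun i => ⟪X i, o⟫_ℝ) i *
        Calc.N 0 ((‖o‖ ^ 2)⁻¹) k (fun i => ⟪X i, o⟫_ℝ) j)) = 4 * Real.pi :=
  base_adm hX hr ho (T := sphπ o) (sphπ_self o) (fun x _ h => sphπ_ker o x h) (α := 0)
    (κ := (‖o‖ ^ 2)⁻¹) (k := k) (y := fun i => ⟪X i, o⟫_ℝ)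
    (by
      intro i j hij
      rw [sphπ_inner _ _ _ (ho.ne_zero hX (by omega)), hk i j hij]
      unfold Calc.M
      rw [real_inner_comm (X i) o, real_inner_comm (X j) o]
      ring)
    (sph_E hX hr ho hk hkk (by
      have := norm_pos_iff.2 (ho.ne_zero hX (by omega)); positivity))

/-- spherical base case, equal norms -/
lemma sph3 [Fintype I] {X Y : I → V} (hX : Good X) (hs : Same X Y) (hr : rk X = 3) {o o' : V}
    (ho : RelInt X o) (ho' : RelInt Y o')
    (hk : ∀ i j, (j = i ∨ j ∈ nb X i) → ⟪X i, X j⟫_ℝ = ⟪Y i, Y j⟫_ℝ)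
    (hno : ‖o‖ = ‖o'‖) (hle : ∀ i, ⟪X i, o⟫_ℝ ≤ ⟪Y i, o'⟫_ℝ) : ∀ i, ⟪X i, o⟫_ℝ = ⟪Y i, o'⟫_ℝ := by
  have hY := hs.good hX
  have hrY : rk Y = 3 := by rw [← hs.rk hX, hr]
  have hkk : ∀ i j, ⟪X i, X j⟫_ℝ = ⟪X j, X i⟫_ℝ := fun i j => real_inner_comm _ _
  obtain ⟨a1, b1⟩ := sph_adm hX hr ho (k := fun i j => ⟪X i, X j⟫_ℝ) (fun i j _ => rfl) hkk
  obtain ⟨a2, b2⟩ := sph_adm hY hrY ho' (k := fun i j => ⟪X i, X j⟫_ℝ)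
    (fun i j h => (hk i j (by rwa [hs.nb i])).symm) hkk
  have hnf : nf Y = nf X := by
    funext i; ext j; rw [mem_nf, mem_nf, hs.nb i]
  rw [hnf] at a2 b2
  rw [← hno] at a2 b2
  have hop := norm_pos_iff.2 (ho.ne_zero hX (by omega))
  refine Calc.main (by positivity) hkk (fun i j => by rw [mem_nf, mem_nf, nb_symm]) ?_
    (nf_pair hX hr) a1 a2 hle (b1.trans b2.symm)
  intro i
  have := norm_pos_iff.2 (hX.ne_zero i)
  rw [real_inner_self_eq_norm_sq]
  positivity

/-- link projection, Euclidean setting -/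
noncomputable def eucπ (h : V →ₗ[ℝ] ℝ) (v : V) : V →ₗ[ℝ] V := LinearMap.id - h.smulRight v

lemma eucπ_apply (h : V →ₗ[ℝ] ℝ) (v x : V) : eucπ h v x = x - h x • v := by simp [eucπ]

lemma eucπ_link (h : V →ₗ[ℝ] ℝ) {X : I → V} {i : I} (hi : h (X i) = 1) : LinkMap X i (eucπ h (X i)) :=
  ⟨by rw [eucπ_apply, hi, one_smul, sub_self],
    fun x hx => by rw [eucπ_apply, sub_eq_zero] at hx; exact ⟨_, hx⟩⟩

lemma euc_adm [Fintype I] {X : I → V} (hX : Good X) (hr : rk X = 3) {o : V} (ho : RelInt X o)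
    (h : V →ₗ[ℝ] ℝ) (h1 : ∀ i, h (X i) = 1) (h2 : h o = 1)
    {k : I → I → ℝ} (hk : ∀ i j, (j = i ∨ j ∈ nb X i) → -‖X i - X j‖ ^ 2 / 2 = k i j) :
    Calc.Adm 1 0 k (nf X) (fun i => -‖X i - o‖ ^ 2 / 2) ∧
    ∑ i, ∑ j ∈ nf X i, Real.arccos (Calc.M 1 0 k (fun i => -‖X i - o‖ ^ 2 / 2) i j /
      √(Calc.N 1 0 k (fun i => -‖X i - o‖ ^ 2 / 2) i *
        Calc.N 1 0 k (fun i => -‖X i - o‖ ^ 2 / 2) j)) = 4 * Real.pi :=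
  base_adm hX hr ho (T := eucπ h o) (by rw [eucπ_apply, h2, one_smul, sub_self])
    (fun x _ hx => ⟨_, sub_eq_zero.1 ((eucπ_apply h o x).symm.trans hx)⟩) (α := 1)
    (κ := 0) (k := k) (y := fun i => -‖X i - o‖ ^ 2 / 2)
    (by
      intro i j hij
      rw [eucπ_apply, eucπ_apply, h1, h1, one_smul]
      unfold Calc.M
      rw [← hk i j hij]
      have : X i - X j = (X i - o) - (X j - o) := by abel
      rw [this, norm_sub_sq_real]
      ring)
    (by
      classical
      intro i
      obtain ⟨j, l, hjl, hn⟩ := hX.rk_three hr i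
      have hset : nf X i = {j, l} := by ext a; rw [mem_nf, hn]; simp
      rw [hset, Finset.sum_pair hjl]
      have hE := Epos hX hr ho hjl hn (eucπ_link h (h1 i))
      simp only [eucπ_apply, h1, h2, one_smul] at hE
      have hii : k i i = 0 := by rw [← hk i i (Or.inl rfl)]; simp
      have key : ∀ j ∈ nb X i, Calc.cc 1 0 k (fun i => -‖X i - o‖ ^ 2 / 2) i j /
          √(Calc.L2 1 0 k i j) = ⟪X j - X i, o - X i⟫_ℝ / ‖X j - X i‖ := by
        intro j hj
        have hij : k i j = -‖X j - X i‖ ^ 2 / 2 := by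
          rw [← hk i j (Or.inr hj), norm_sub_rev]
        have hjj : k j j = 0 := by rw [← hk j j (Or.inl rfl)]; simp
        have e1 : Calc.L2 1 0 k i j = ‖X j - X i‖ ^ 2 := by
          unfold Calc.L2; rw [hij, hii, hjj]; ring
        rw [e1, Real.sqrt_sq (norm_nonneg _)]
        congr 1
        unfold Calc.cc
        have e2 : X j - o = (X j - X i) - (o - X i) := by abel
        rw [hij, hii]
        simp only []
        rw [e2, norm_sub_sq_real (X j - X i) (o - X i), norm_sub_rev (X i) o]
        ring
      rw [key j (by rw [hn]; simp), key l (by rw [hn]; simp)]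
      exact hE)

/-- Euclidean base case -/
lemma euc3 [Fintype I] {X Y : I → V} (hX : Good X) (hs : Same X Y) (hr : rk X = 3) {o o' : V}
    (ho : RelInt X o) (ho' : RelInt Y o')
    (h h' : V →ₗ[ℝ] ℝ) (h1 : ∀ i, h (X i) = 1) (h2 : h o = 1)
    (h1' : ∀ i, h' (Y i) = 1) (h2' : h' o' = 1)
    (hk : ∀ i j, (j = i ∨ j ∈ nb X i) → ‖X i - X j‖ = ‖Y i - Y j‖)
    (hle : ∀ i, ‖Y i - o'‖ ≤ ‖X i - o‖) : ∀ i, ‖X i - o‖ = ‖Y i - o'‖ := by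
  have hY := hs.good hX
  have hrY : rk Y = 3 := by rw [← hs.rk hX, hr]
  obtain ⟨a1, b1⟩ := euc_adm hX hr ho h h1 h2 (k := fun i j => -‖X i - X j‖ ^ 2 / 2)
    (fun i j _ => rfl)
  obtain ⟨a2, b2⟩ := euc_adm hY hrY ho' h' h1' h2' (k := fun i j => -‖X i - X j‖ ^ 2 / 2)
    (fun i j hij => by rw [hk i j (by rwa [hs.nb i])])
  have hnf : nf Y = nf X := by
    funext i; ext j; rw [mem_nf, mem_nf, hs.nb i]
  rw [hnf] at a2 b2
  have := Calc.main le_rfl (fun i j => by rw [norm_sub_rev])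
    (fun i j => by rw [mem_nf, mem_nf, nb_symm]) (by simp)
    (nf_pair hX hr) a1 a2 (fun i => by
      have := hle i
      have := norm_nonneg (Y i - o')
      nlinarith) (b1.trans b2.symm)
  intro i
  have := this i
  have e : ‖X i - o‖ ^ 2 = ‖Y i - o'‖ ^ 2 := by linarith
  exact (pow_left_inj₀ (norm_nonneg _) (norm_nonneg _) two_ne_zero).1 e

end Base
end ISim

namespace ISim

open scoped InnerProductSpace

section Wsph

variable {V : Type*} [NormedAddCommGroup V] [InnerProductSpace ℝ V]

lemma relInt_comb {I : Type*} [Fintype I] {X : I → V} {o : V} (ho : RelInt X o) :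
    ∃ c : I → ℝ, (∀ i, 0 ≤ c i) ∧ o = ∑ i, c i • X i := by
  rcases farkas_line X 0 o with ⟨c, t, hc, h⟩ | ⟨l, h1, -, h3⟩
  · exact ⟨c, hc, by simpa using h⟩
  · exfalso
    by_cases h : ∃ i, l (X i) ≠ 0
    · have := ho.pos l h1 h
      linarith
    · push Not at h
      have : Submodule.span ℝ (range X) ≤ LinearMap.ker l := by
        rw [Submodule.span_le]
        rintro _ ⟨i, rfl⟩
        exact h i
      have := this ho.mem
      rw [LinearMap.mem_ker] at this
      linarith

lemma minpt {I : Type*} [Fintype I] [Nonempty I] {X : I → V} (hX : Good X) :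
    ∃ e : V, e ∈ Submodule.span ℝ (range X) ∧ (∀ i, 0 < ⟪X i, e⟫_ℝ) ∧
      ∀ l : V →ₗ[ℝ] ℝ, (∀ i, 0 ≤ l (X i)) → 0 ≤ l e := by
  have hcomp : IsCompact (convexHull ℝ (range X)) := (finite_range X).isCompact_convexHull ℝ
  have hconv : Convex ℝ (convexHull ℝ (range X)) := convex_convexHull ℝ _
  have hne : (convexHull ℝ (range X)).Nonempty := (range_nonempty X).convexHull
  obtain ⟨e, he, hmin⟩ := exists_norm_eq_iInf_of_complete_convex hne hcomp.isComplete hconv 0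
  have h1 := (norm_eq_iInf_iff_real_inner_le_zero hconv he).1 hmin
  have hl : ∀ (l : V →ₗ[ℝ] ℝ) (c : ℝ), (∀ i, c ≤ l (X i)) → c ≤ l e := by
    intro l c hc
    have : convexHull ℝ (range X) ⊆ {x | c ≤ l x} := by
      apply convexHull_min
      · rintro _ ⟨i, rfl⟩; exact hc i
      · exact convex_halfSpace_ge l.isLinear c
    exact this he
  have he0 : e ≠ 0 := by
    rintro rfl
    obtain ⟨l, h⟩ := hX.posfun
    obtain ⟨i0, hi0⟩ := Finite.exists_min (fun i => l (X i))
    have := hl l (l (X i0)) hi0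
    simp at this
    linarith [h i0]
  refine ⟨e, convexHull_subset_affineSpan (s := range X) |>.trans affineSpan_subset_span he, ?_, fun l h => hl l 0 h⟩
  intro i
  have := h1 (X i) (subset_convexHull ℝ _ ⟨i, rfl⟩)
  have hp : 0 < ‖e‖ ^ 2 := by have := norm_pos_iff.2 he0; positivity
  rw [← real_inner_self_eq_norm_sq] at hp
  simp only [zero_sub, inner_neg_left, inner_sub_right] at this
  rw [real_inner_comm]
  linarith

lemma wsph3 {I : Type*} [Fintype I] {X Y : I → V} (hX : Good X) (hs : Same X Y) (hr : rk X = 3) {o o' : V}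
    (ho : RelInt X o) (ho' : RelInt Y o')
    (hk : ∀ i j, (j = i ∨ j ∈ nb X i) → ⟪X i, X j⟫_ℝ = ⟪Y i, Y j⟫_ℝ)
    (hno : ‖o'‖ ≤ ‖o‖) (hle : ∀ i, ⟪X i, o⟫_ℝ ≤ ⟪Y i, o'⟫_ℝ) :
    (∀ i, ⟪X i, o⟫_ℝ = ⟪Y i, o'⟫_ℝ) ∧ ‖o'‖ = ‖o‖ := by
  have hne : Nonempty I := by
    by_contra hI
    rw [not_nonempty_iff] at hI
    rw [rk_empty] at hr
    omega
  have hY := hs.good hX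
  obtain ⟨e, he1, he2, he3⟩ := minpt hY
  have he0 : e ≠ 0 := by
    rintro rfl
    obtain ⟨i⟩ := hne
    simpa using he2 i
  have hep := norm_pos_iff.2 he0
  have hcont : Continuous (fun τ : ℝ => ‖o' + τ • e‖) := by fun_prop
  have hT : 0 ≤ (‖o‖ + ‖o'‖) / ‖e‖ := by positivity
  have hivt := intermediate_value_Icc hT hcont.continuousOn
  obtain ⟨τ, ⟨hτ, -⟩, hτe⟩ := hivt (show ‖o‖ ∈ _ from ⟨by simpa using hno, by
    have h1 : ‖((‖o‖ + ‖o'‖) / ‖e‖) • e‖ = ‖o‖ + ‖o'‖ := by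
      rw [norm_smul, Real.norm_of_nonneg hT]; field_simp
    have h2 := norm_sub_le (o' + ((‖o‖ + ‖o'‖) / ‖e‖) • e) o'
    rw [add_sub_cancel_left, h1] at h2
    linarith⟩)
  simp only at hτe
  have hrel : RelInt Y (o' + τ • e) := by
    refine ⟨Submodule.add_mem _ ho'.mem (Submodule.smul_mem _ _ he1), ?_⟩
    intro l h1 h2
    have := ho'.pos l h1 h2
    have := mul_nonneg hτ (he3 l h1)
    simp only [map_add, map_smul, smul_eq_mul]
    linarith
  have hin : ∀ i, ⟪Y i, o' + τ • e⟫_ℝ = ⟪Y i, o'⟫_ℝ + τ * ⟪Y i, e⟫_ℝ := by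
    intro i; rw [inner_add_right, real_inner_smul_right]
  have key := sph3 hX hs hr ho hrel hk hτe.symm (by
    intro i
    rw [hin]
    have := mul_nonneg hτ (he2 i).le
    linarith [hle i])
  have hτ0 : τ = 0 := by
    obtain ⟨i⟩ := hne
    have h1 := key i
    rw [hin] at h1
    have h2 := hle i
    have h3 := he2 i
    by_contra hc
    have : 0 < τ := lt_of_le_of_ne hτ (Ne.symm hc)
    have := mul_pos this h3
    linarith
  rw [hτ0, zero_smul, add_zero] at key hτe
  exact ⟨key, hτe⟩

theorem wsph.{u} : ∀ n : ℕ, 3 ≤ n → ∀ {I : Type u} [Finite I] {X Y : I → V} (_ : Good X) (_ : Same X Y)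
    (_ : rk X = n) (_ : ∀ s, FF X s → s ≠ univ → ∀ i ∈ s, ∀ j ∈ s, ⟪X i, X j⟫_ℝ = ⟪Y i, Y j⟫_ℝ)
    {o o' : V} (_ : RelInt X o) (_ : RelInt Y o') (_ : ‖o'‖ ≤ ‖o‖) (_ : ∀ i, ⟪X i, o⟫_ℝ ≤ ⟪Y i, o'⟫_ℝ),
    (∀ i, ⟪X i, o⟫_ℝ = ⟪Y i, o'⟫_ℝ) ∧ ‖o'‖ = ‖o‖ := by
  intro n hn
  induction n, hn using Nat.le_induction with
  | base =>
    intro I _ X Y hX hs hr hk o o' ho ho' hno hle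
    have := Fintype.ofFinite I
    refine wsph3 hX hs hr ho ho' ?_ hno hle
    rintro i j (rfl | hj)
    · exact hk {j} (hX.single j) (by
        have := pair_ne_univ (X := X) (by omega) j j
        simpa using this) j rfl j rfl
    · exact hk {i, j} hj.2 (pair_ne_univ (X := X) (by omega) i j) i (by simp) j (by simp)
  | succ n hn ih =>
    intro I _ X Y hX hs hr hk o o' ho ho' hno hle
    have := Fintype.ofFinite I
    have hY := hs.good hX
    have ho0 : 0 < ‖o‖ := norm_pos_iff.2 (ho.ne_zero hX (by omega))
    have hkii : ∀ i, ‖X i‖ ^ 2 = ‖Y i‖ ^ 2 := by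
      intro i
      have := hk {i} (hX.single i) (by
        have := pair_ne_univ (X := X) (by omega) i i
        simpa using this) i rfl i rfl
      rwa [real_inner_self_eq_norm_sq, real_inner_self_eq_norm_sq] at this
    -- general propagation
    have step : ∀ o'' : V, RelInt Y o'' → ‖o''‖ ≤ ‖o‖ → (∀ i, ⟪X i, o⟫_ℝ ≤ ⟪Y i, o''⟫_ℝ) →
        (∃ i, ⟪X i, o⟫_ℝ = ⟪Y i, o''⟫_ℝ) → (∀ i, ⟪X i, o⟫_ℝ = ⟪Y i, o''⟫_ℝ) ∧ ‖o''‖ = ‖o‖ := by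
      intro o'' ho'' hno'' hle'' hex
      have prop : ∀ i, ⟪X i, o⟫_ℝ = ⟪Y i, o''⟫_ℝ →
          (∀ j ∈ nb X i, ⟪X j, o⟫_ℝ = ⟪Y j, o''⟫_ℝ) ∧ ‖o''‖ = ‖o‖ := by
        intro i hi
        have hπ := sphπ_link X i
        have hπ' := sphπ_link Y i
        have hrk : rk (lk X i (sphπ (X i))) = n := by
          have := hπ.rk hX; omega
        have hnp : 0 < ‖X i‖ ^ 2 := by have := norm_pos_iff.2 (hX.ne_zero i); positivity
        have hij : ∀ j ∈ nb X i, ⟪X i, X j⟫_ℝ = ⟪Y i, Y j⟫_ℝ := fun j hj =>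
          hk {i, j} hj.2 (pair_ne_univ (X := X) (by omega) i j) i (by simp) j (by simp)
        have e1 : ‖sphπ (X i) o‖ ^ 2 = ‖o‖ ^ 2 - ⟪X i, o⟫_ℝ * ⟪X i, o⟫_ℝ / ‖X i‖ ^ 2 := by
          rw [← real_inner_self_eq_norm_sq, sphπ_inner _ _ _ (hX.ne_zero i), real_inner_self_eq_norm_sq]
        have e2 : ‖sphπ (Y i) o''‖ ^ 2 = ‖o''‖ ^ 2 - ⟪X i, o⟫_ℝ * ⟪X i, o⟫_ℝ / ‖X i‖ ^ 2 := by
          rw [← real_inner_self_eq_norm_sq, sphπ_inner _ _ _ (hY.ne_zero i), real_inner_self_eq_norm_sq,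
            hkii, hi]
        have e3 : ∀ j : nb X i, ⟪lk X i (sphπ (X i)) j, sphπ (X i) o⟫_ℝ =
            ⟪X j, o⟫_ℝ - ⟪X i, X j⟫_ℝ * ⟪X i, o⟫_ℝ / ‖X i‖ ^ 2 := by
          intro j
          exact sphπ_inner _ _ _ (hX.ne_zero i)
        have e4 : ∀ j : nb X i, ⟪lk2 X Y i (sphπ (Y i)) j, sphπ (Y i) o''⟫_ℝ =
            ⟪Y j, o''⟫_ℝ - ⟪X i, X j⟫_ℝ * ⟪X i, o⟫_ℝ / ‖X i‖ ^ 2 := by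
          intro j
          rw [hij j j.2, hi, hkii]
          exact sphπ_inner _ _ _ (hY.ne_zero i)
        have := ih (hπ.good hX) (hs.lk2_same hX i hπ hπ') hrk ?_ (hπ.relInt hX ho)
          (hs.lk2_relInt hX i hπ' ho'') ?_ ?_
        · obtain ⟨h1, h2⟩ := this
          constructor
          · intro j hj
            have := h1 ⟨j, hj⟩
            rw [e3, e4] at this
            simp only at this
            linarith
          · have : ‖sphπ (Y i) o''‖ ^ 2 = ‖sphπ (X i) o‖ ^ 2 := by rw [h2]
            rw [e1, e2] at this
            have : ‖o''‖ ^ 2 = ‖o‖ ^ 2 := by linarith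
            exact (pow_left_inj₀ (norm_nonneg _) (norm_nonneg _) two_ne_zero).1 this
        · intro s' hs' hsu a ha b hb
          rw [hπ.face hX] at hs'
          obtain ⟨s, hsf, his, rfl⟩ := hs'
          have hsne : s ≠ univ := by rintro rfl; exact hsu (by simp)
          have g := hk s hsf hsne
          have l1 : ⟪lk X i (sphπ (X i)) a, lk X i (sphπ (X i)) b⟫_ℝ =
            ⟪X a, X b⟫_ℝ - ⟪X i, X a⟫_ℝ * ⟪X i, X b⟫_ℝ / ‖X i‖ ^ 2 := sphπ_inner _ _ _ (hX.ne_zero i)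
          have l2 : ⟪lk2 X Y i (sphπ (Y i)) a, lk2 X Y i (sphπ (Y i)) b⟫_ℝ =
            ⟪Y a, Y b⟫_ℝ - ⟪Y i, Y a⟫_ℝ * ⟪Y i, Y b⟫_ℝ / ‖Y i‖ ^ 2 := sphπ_inner _ _ _ (hY.ne_zero i)
          rw [l1, l2, g a ha b hb, g i his a ha, g i his b hb, hkii]
        · have : ‖sphπ (Y i) o''‖ ^ 2 ≤ ‖sphπ (X i) o‖ ^ 2 := by
            rw [e1, e2]
            have := pow_le_pow_left₀ (norm_nonneg _) hno'' 2
            linarith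
          exact (pow_le_pow_iff_left₀ (norm_nonneg _) (norm_nonneg _) two_ne_zero).1 this
        · intro j
          rw [e3, e4]
          linarith [hle'' j]
      obtain ⟨i0, hi0⟩ := hex
      refine ⟨?_, (prop i0 hi0).2⟩
      exact fun v => hX.conn {i | ⟪X i, o⟫_ℝ = ⟪Y i, o''⟫_ℝ} ⟨i0, hi0⟩ (fun i hi j hj => (prop i hi).1 j hj) v
    obtain ⟨c, hc, hoc⟩ := relInt_comb ho
    have hpos : ∃ i, 0 < ⟪X i, o⟫_ℝ := by
      by_contra hcon
      push Not at hcon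
      have h1 : ‖o‖ ^ 2 = ∑ i, c i * ⟪X i, o⟫_ℝ := by
        rw [← real_inner_self_eq_norm_sq]
        nth_rewrite 1 [hoc]
        rw [sum_inner]
        simp only [real_inner_smul_left]
      have h2 : ∑ i, c i * ⟪X i, o⟫_ℝ ≤ 0 :=
        Finset.sum_nonpos fun i _ => mul_nonpos_of_nonneg_of_nonpos (hc i) (hcon i)
      have : 0 < ‖o‖ ^ 2 := by positivity
      linarith
    obtain ⟨i1, hi1⟩ := hpos
    obtain ⟨⟨i0, hi0⟩, hmax⟩ := by
      haveI : Nonempty {i // 0 < ⟪X i, o⟫_ℝ} := ⟨⟨i1, hi1⟩⟩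
      exact Finite.exists_max (fun i : {i // 0 < ⟪X i, o⟫_ℝ} => ⟪X i, o⟫_ℝ / ⟪Y i, o'⟫_ℝ)
    set s := ⟪X i0, o⟫_ℝ / ⟪Y i0, o'⟫_ℝ with hsdef
    have hy0 : 0 < ⟪Y i0, o'⟫_ℝ := hi0.trans_le (hle i0)
    have hs0 : 0 < s := div_pos hi0 hy0
    have hs1 : s ≤ 1 := (div_le_one hy0).2 (hle i0)
    have hY' : ∀ i, ⟪Y i, s • o'⟫_ℝ = s * ⟪Y i, o'⟫_ℝ := fun i => real_inner_smul_right _ _ _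
    have hnorm : ‖s • o'‖ = s * ‖o'‖ := by rw [norm_smul, Real.norm_of_nonneg hs0.le]
    obtain ⟨h1, h2⟩ := step (s • o') ⟨Submodule.smul_mem _ _ ho'.mem, fun l a b => by
        have := ho'.pos l a b
        rw [map_smul, smul_eq_mul]; positivity⟩
      (by rw [hnorm]; nlinarith [norm_nonneg o'])
      (by
        intro i
        rw [hY']
        by_cases hi : 0 < ⟪X i, o⟫_ℝ
        · have := hmax ⟨i, hi⟩
          simp only at this
          rwa [div_le_iff₀ (hi.trans_le (hle i))] at this
        · push Not at hi
          have := hle i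
          rcases le_total 0 ⟪Y i, o'⟫_ℝ with h | h
          · have := mul_nonneg hs0.le h
            linarith
          · nlinarith)
      ⟨i0, by rw [hY', hsdef]; field_simp⟩
    have hs1' : s = 1 := by
      rw [hnorm] at h2
      apply le_antisymm hs1
      by_contra hc
      push Not at hc
      nlinarith
    rw [hs1', one_smul] at h1 h2
    exact ⟨h1, h2⟩

end Wsph
end ISim

namespace ISim

open scoped InnerProductSpace

section Weuc

variable {V : Type*} [NormedAddCommGroup V] [InnerProductSpace ℝ V]

lemma inner_eq_dist (x y : V) : ⟪x, y⟫_ℝ = (‖x‖ ^ 2 + ‖y‖ ^ 2 - ‖x - y‖ ^ 2) / 2 := by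
  rw [norm_sub_sq_real]; ring

theorem weuc {I : Type*} [Finite I] {X Y : I → V} (hX : Good X) (hs : Same X Y) (hr : 3 ≤ rk X)
    (h h' : V →ₗ[ℝ] ℝ) (h1 : ∀ i, h (X i) = 1) {o o' : V} (h2 : h o = 1)
    (h1' : ∀ i, h' (Y i) = 1) (h2' : h' o' = 1)
    (hk : ∀ s, FF X s → s ≠ univ → ∀ i ∈ s, ∀ j ∈ s, ‖X i - X j‖ = ‖Y i - Y j‖)
    (ho : RelInt X o) (ho' : RelInt Y o')
    (hle : ∀ i, ‖Y i - o'‖ ≤ ‖X i - o‖) : ∀ i, ‖X i - o‖ = ‖Y i - o'‖ := by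
  have := Fintype.ofFinite I
  have hkn : ∀ i, ∀ j ∈ nb X i, ‖X i - X j‖ = ‖Y i - Y j‖ := fun i j hj =>
    hk {i, j} hj.2 (pair_ne_univ (X := X) (by omega) i j) i (by simp) j (by simp)
  rcases eq_or_lt_of_le hr with hr3 | hr4
  · refine euc3 hX hs hr3.symm ho ho' h h' h1 h2 h1' h2' ?_ hle
    rintro i j (rfl | hj)
    · simp
    · exact hkn i j hj
  have hY := hs.good hX
  have hne : Nonempty I := by
    by_contra hI
    rw [not_nonempty_iff] at hI
    rw [rk_empty] at hr
    omega
  obtain ⟨i0, hmin⟩ := Finite.exists_min (fun i => ‖X i - o‖ ^ 2 - ‖Y i - o'‖ ^ 2)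
  set μ := ‖X i0 - o‖ ^ 2 - ‖Y i0 - o'‖ ^ 2 with hμ
  have prop : ∀ i, ‖X i - o‖ ^ 2 - ‖Y i - o'‖ ^ 2 = μ →
      (∀ j ∈ nb X i, ‖X j - o‖ ^ 2 - ‖Y j - o'‖ ^ 2 = μ) ∧ μ = 0 := by
    intro i hi
    have hπ := eucπ_link h (X := X) (h1 i)
    have hπ' := eucπ_link h' (X := Y) (h1' i)
    have a1 : ∀ j : nb X i, lk X i (eucπ h (X i)) j = X j - X i := by
      intro j; simp [lk, eucπ_apply, h1]
    have a2 : ∀ j : nb X i, lk2 X Y i (eucπ h' (Y i)) j = Y j - Y i := by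
      intro j; simp [lk2, eucπ_apply, h1']
    have a3 : eucπ h (X i) o = o - X i := by simp [eucπ_apply, h2]
    have a4 : eucπ h' (Y i) o' = o' - Y i := by simp [eucπ_apply, h2']
    have := wsph (rk (lk X i (eucπ h (X i)))) (by have := hπ.rk hX; omega) (hπ.good hX)
      (hs.lk2_same hX i hπ hπ') rfl ?_ (hπ.relInt hX ho) (hs.lk2_relInt hX i hπ' ho') ?_ ?_
    · obtain ⟨b1, b2⟩ := this
      rw [a3, a4, norm_sub_rev, norm_sub_rev o] at b2
      have hμ0 : μ = 0 := by rw [← hi, b2]; ring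
      refine ⟨?_, hμ0⟩
      intro j hj
      have := b1 ⟨j, hj⟩
      rw [a1, a2, a3, a4, inner_eq_dist, inner_eq_dist] at this
      simp only [sub_sub_sub_cancel_right] at this
      rw [norm_sub_rev _ (X i), norm_sub_rev _ (Y i), hkn i j hj, norm_sub_rev o, norm_sub_rev o', b2] at this
      linarith
    · intro s' hs' hsu a ha b hb
      rw [hπ.face hX] at hs'
      obtain ⟨s, hsf, his, rfl⟩ := hs'
      have hsne : s ≠ univ := by rintro rfl; exact hsu (by simp)
      have g := hk s hsf hsne
      rw [a1, a1, a2, a2, inner_eq_dist, inner_eq_dist (Y a - Y i)]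
      simp only [sub_sub_sub_cancel_right]
      rw [g a ha i his, g b hb i his, g a ha b hb]
    · rw [a3, a4, norm_sub_rev, norm_sub_rev o]
      exact hle i
    · intro j
      rw [a1, a2, a3, a4, inner_eq_dist, inner_eq_dist (Y j - Y i)]
      simp only [sub_sub_sub_cancel_right]
      rw [norm_sub_rev _ (X i), norm_sub_rev _ (Y i), hkn i j j.2, norm_sub_rev o, norm_sub_rev o']
      have := hmin j
      linarith
  have hall : ∀ v, ‖X v - o‖ ^ 2 - ‖Y v - o'‖ ^ 2 = μ := fun v =>
    hX.conn {i | ‖X i - o‖ ^ 2 - ‖Y i - o'‖ ^ 2 = μ} ⟨i0, rfl⟩ (fun i hi j hj => (prop i hi).1 j hj) v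
  intro i
  have e := hall i
  rw [(prop i0 rfl).2] at e
  exact (pow_left_inj₀ (norm_nonneg _) (norm_nonneg _) two_ne_zero).1 (by linarith)

end Weuc
end ISim

namespace ISim

open scoped InnerProductSpace

section Core

variable {V : Type*} [NormedAddCommGroup V] [InnerProductSpace ℝ V]

/-- homogenization -/
def hom {I : Type*} (p : I → V) : I → V × ℝ := fun i => (p i, 1)

/-- link projection of the homogenization -/
def homπ (x : V) : V × ℝ →ₗ[ℝ] V := LinearMap.fst ℝ V ℝ - (LinearMap.snd ℝ V ℝ).smulRight x

lemma homπ_apply (x : V) (y : V × ℝ) : homπ x y = y.1 - y.2 • x := by simp [homπ]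

variable {I : Type*}

lemma homπ_hom (p : I → V) (x : V) (i : I) : homπ x (hom p i) = p i - x := by
  simp [homπ_apply, hom]

lemma homπ_link (p : I → V) (i : I) : LinkMap (hom p) i (homπ (p i)) := by
  refine ⟨by simp [homπ_hom], fun x hx => ⟨x.2, ?_⟩⟩
  rw [homπ_apply, sub_eq_zero] at hx
  ext
  · simpa [hom] using hx
  · simp [hom]

lemma hom_inj {p : I → V} (hp : Good (hom p)) {i j : I} (h : p i = p j) : i = j := by
  have h1 : hom p i = hom p j := by simp [hom, h]
  obtain ⟨l, -, h2⟩ := hp.single i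
  have : j ∈ ({i} : Set I) := by rw [h2, ← h1, ← h2]; rfl
  exact (mem_singleton_iff.1 this).symm

lemma hom_pos {p : I → V} (hp : Good (hom p)) {i j : I} (h : i ≠ j) : 0 < ‖p i - p j‖ := by
  rw [norm_pos_iff, sub_ne_zero]
  exact fun h' => h (hom_inj hp h')

lemma inv_dist {x y : V} {ℓ : ℝ} (hℓ : 0 < ℓ) (hx : ‖x‖ = ℓ) (hy : y ≠ 0) :
    ‖x - (ℓ ^ 2 / ‖y‖ ^ 2) • y‖ = ℓ * ‖x - y‖ / ‖y‖ := by
  have hyp := norm_pos_iff.2 hy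
  have h1 : ‖x - (ℓ ^ 2 / ‖y‖ ^ 2) • y‖ ^ 2 = (ℓ * ‖x - y‖ / ‖y‖) ^ 2 := by
    rw [div_pow, mul_pow, norm_sub_sq_real, norm_sub_sq_real, norm_smul, real_inner_smul_right, hx,
      Real.norm_of_nonneg (by positivity)]
    field_simp
    ring
  exact (pow_left_inj₀ (norm_nonneg _) (by positivity) two_ne_zero).1 h1

lemma insc {p : I → V} {c : V} {r : ℝ} (hc : ∀ i, dist (p i) c = r) (i j : I) :
    2 * ⟪c - p i, p j - p i⟫_ℝ = ‖p j - p i‖ ^ 2 := by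
  have h1 : ‖p j - c‖ = ‖p i - c‖ := by rw [← dist_eq_norm, ← dist_eq_norm, hc, hc]
  have e : p j - c = (p j - p i) - (c - p i) := by abel
  rw [e, norm_sub_rev (p i) c] at h1
  have h2 : ‖p j - p i - (c - p i)‖ ^ 2 = ‖c - p i‖ ^ 2 := by rw [h1]
  rw [norm_sub_sq_real] at h2
  rw [real_inner_comm]
  linarith

/-- algebra: isoceles triangle with circumcentre -/
lemma circum {x y u : V} {ℓ R : ℝ} (hℓ : 0 < ℓ) (hx : ‖x‖ = ℓ) (hy : ‖y‖ = ℓ)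
    (hux : 2 * ⟪u, x⟫_ℝ = ℓ ^ 2) (huy : 2 * ⟪u, y⟫_ℝ = ℓ ^ 2) (hR : ‖u‖ = R) {α β : ℝ}
    (hu : u = α • x + β • y) (hxy : x ≠ y) : (‖x - y‖ / ℓ) ^ 2 = 4 - ℓ ^ 2 / R ^ 2 := by
  have hxy' : 0 < ‖x - y‖ ^ 2 := by
    have := norm_pos_iff.2 (sub_ne_zero.2 hxy); positivity
  have e1 : ‖x - y‖ ^ 2 = 2 * ℓ ^ 2 - 2 * ⟪x, y⟫_ℝ := by rw [norm_sub_sq_real, hx, hy]; ring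
  have e2 : ⟪u, x⟫_ℝ = α * ℓ ^ 2 + β * ⟪x, y⟫_ℝ := by
    rw [hu, inner_add_left, real_inner_smul_left, real_inner_smul_left, real_inner_self_eq_norm_sq, hx,
      real_inner_comm x y]
  have e3 : ⟪u, y⟫_ℝ = α * ⟪x, y⟫_ℝ + β * ℓ ^ 2 := by
    rw [hu, inner_add_left, real_inner_smul_left, real_inner_smul_left, real_inner_self_eq_norm_sq, hy]
  have e4 : R ^ 2 = α * ⟪u, x⟫_ℝ + β * ⟪u, y⟫_ℝ := by
    rw [← hR, ← real_inner_self_eq_norm_sq]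
    nth_rewrite 2 [hu]
    rw [inner_add_right, real_inner_smul_right, real_inner_smul_right]
  set t := ⟪x, y⟫_ℝ
  have e5 : α = β := by
    have : (α - β) * (ℓ ^ 2 - t) = 0 := by linarith
    rcases mul_eq_zero.1 this with h | h
    · linarith
    · nlinarith
  subst e5
  have e6 : R ^ 2 = α * ℓ ^ 2 := by nlinarith
  have hα : α ≠ 0 := by
    rintro rfl
    have : 0 < ℓ ^ 2 := by positivity
    linarith
  rw [div_pow, e1, e6]
  have e7 : 2 * (α * (ℓ ^ 2 + t)) = ℓ ^ 2 := by linarith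
  field_simp
  linear_combination -e7

lemma span2 [Fintype I] {p : I → V} (hp : Good (hom p)) {i j l : I} (hjl : j ≠ l)
    (hn : nb (hom p) i = {j, l}) (v : I) : ∃ α β : ℝ, 0 ≤ α ∧ 0 ≤ β ∧
      p v - p i = α • (p j - p i) + β • (p l - p i) := by
  classical
  obtain ⟨t, c, h1, h2, h3⟩ := hp.gen' i v
  refine ⟨c j, c l, h1 j, h1 l, ?_⟩
  have h4 := congrArg (homπ (p i)) h3
  rw [map_add, map_smul, (homπ_link p i).zero, smul_zero, zero_add, map_sum, homπ_hom] at h4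
  rw [h4, ← Finset.sum_subset (Finset.subset_univ {j, l}), Finset.sum_pair hjl]
  · simp [homπ_hom]
  · intro x _ hx
    rw [h2 x (by rw [hn]; simpa using hx)]
    simp

lemma planar_center [Fintype I] {p : I → V} (hp : Good (hom p)) (hr : rk (hom p) = 3) {c : V} {r : ℝ}
    (hc : ∀ i, dist (p i) c = r) : ∃ (c' : V) (r' : ℝ), (∀ i, dist (p i) c' = r') ∧
      ∀ i j l, j ≠ l → nb (hom p) i = {j, l} → ∃ α β : ℝ, c' - p i = α • (p j - p i) + β • (p l - p i) := by
  have hne : Nonempty I := by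
    by_contra hI
    rw [not_nonempty_iff] at hI
    rw [rk_empty] at hr
    omega
  obtain ⟨i0⟩ := hne
  let S : Submodule ℝ V := Submodule.span ℝ (range (fun k => p k - p i0))
  have hfin : FiniteDimensional ℝ S := FiniteDimensional.span_of_finite ℝ (finite_range _)
  have hS : ∀ k, p k - p i0 ∈ S := fun k => Submodule.subset_span ⟨k, rfl⟩
  let c' : V := p i0 + S.starProjection (c - p i0)
  have hcS : ∀ i, c' - p i ∈ S := by
    intro i
    have : c' - p i = S.starProjection (c - p i0) - (p i - p i0) := by simp only [c']; abel
    rw [this]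
    exact S.sub_mem (Submodule.starProjection_apply_mem S _) (hS i)
  have horth : ∀ w ∈ S, ⟪c - c', w⟫_ℝ = 0 := by
    intro w hw
    have : c - c' = (c - p i0) - S.starProjection (c - p i0) := by simp only [c']; abel
    rw [this]
    exact Submodule.starProjection_inner_eq_zero _ w hw
  refine ⟨c', √(r ^ 2 - ‖c - c'‖ ^ 2), ?_, ?_⟩
  · intro i
    have h1 : ‖c - p i‖ ^ 2 = ‖c - c'‖ ^ 2 + ‖c' - p i‖ ^ 2 := by
      have : c - p i = (c - c') + (c' - p i) := by abel
      rw [this, norm_add_sq_real, horth _ (hcS i)]; ring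
    rw [← hc i, dist_eq_norm, dist_eq_norm, norm_sub_rev (p i) c, h1, add_sub_cancel_left,
      Real.sqrt_sq (norm_nonneg _), norm_sub_rev]
  · intro i j l hjl hn
    have hle : S ≤ Submodule.span ℝ {p j - p i, p l - p i} := by
      rw [Submodule.span_le]
      have hm : ∀ k, p k - p i ∈ Submodule.span ℝ {p j - p i, p l - p i} := by
        intro k
        obtain ⟨α, β, -, -, h⟩ := span2 hp hjl hn k
        rw [Submodule.mem_span_pair]
        exact ⟨α, β, h.symm⟩
      rintro _ ⟨k, rfl⟩
      have : p k - p i0 = (p k - p i) - (p i0 - p i) := by abel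
      simp only [this]
      exact Submodule.sub_mem _ (hm k) (hm i0)
    have := hle (hcS i)
    rw [Submodule.mem_span_pair] at this
    obtain ⟨α, β, h⟩ := this
    exact ⟨α, β, h.symm⟩

lemma rk3_sum [Fintype I] {p : I → V} (hp : Good (hom p)) (hr : rk (hom p) = 3) {c : V} {r : ℝ}
    (hc : ∀ i, dist (p i) c = r) {ℓ : ℝ} (hℓ : 0 < ℓ)
    (he : ∀ i, ∀ j ∈ nb (hom p) i, ‖p j - p i‖ = ℓ) :
    ∃ D, ∀ v i, i ≠ v → ∑ j ∈ nf (hom p) i, ‖p j - p v‖ = D * ‖p i - p v‖ := by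
  classical
  obtain ⟨c', r', hc', hsp⟩ := planar_center hp hr hc
  refine ⟨√(4 - ℓ ^ 2 / r' ^ 2), ?_⟩
  intro v i hiv
  obtain ⟨j, l, hjl, hn⟩ := hp.rk_three hr i
  have hset : nf (hom p) i = {j, l} := by ext a; rw [mem_nf, hn]; simp
  have hj : ‖p j - p i‖ = ℓ := he i j (by rw [hn]; simp)
  have hl : ‖p l - p i‖ = ℓ := he i l (by rw [hn]; simp)
  rw [hset, Finset.sum_pair hjl]
  obtain ⟨α, β, hu⟩ := hsp i j l hjl hn
  have hD := circum hℓ hj hl (by rw [insc hc', hj]) (by rw [insc hc', hl])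
    (R := r') (by rw [← hc' i, dist_eq_norm, norm_sub_rev]) hu
    (by intro h; exact hjl (hom_inj hp (sub_left_injective h)))
  rw [← hD, Real.sqrt_sq (by positivity), sub_sub_sub_cancel_right]
  obtain ⟨a, b, ha, hb, hv⟩ := span2 hp hjl hn v
  have hy : p v - p i ≠ 0 := sub_ne_zero.2 fun h => hiv (hom_inj hp h).symm
  have hyp := norm_pos_iff.2 hy
  set y := p v - p i with hydef
  have e1 := inv_dist hℓ hj hy
  have e2 := inv_dist hℓ hl hy
  have hab : a * ℓ ^ 2 + b * ℓ ^ 2 = ‖y‖ ^ 2 := by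
    rw [hydef, ← insc hc' i v, ← hydef, hv, inner_add_right, real_inner_smul_right, real_inner_smul_right]
    have h1 := insc hc' i j
    have h2 := insc hc' i l
    rw [hj] at h1
    rw [hl] at h2
    rw [← h1]
    nth_rewrite 2 [h1]
    rw [← h2]; ring
  set κ := ℓ ^ 2 / ‖y‖ ^ 2 with hκ
  have hk1 : κ * a + κ * b = 1 := by
    rw [hκ, ← mul_add, ← hab]
    have : a * ℓ ^ 2 + b * ℓ ^ 2 ≠ 0 := by rw [hab]; positivity
    have h3 : a + b ≠ 0 := by intro h; apply this; rw [← add_mul, h, zero_mul]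
    field_simp
  have f1 : p j - p i - κ • y = (κ * b) • (p j - p l) := by
    have : p j - p i = (κ * a + κ * b) • (p j - p i) := by rw [hk1, one_smul]
    rw [this, hv]
    module
  have f2 : p l - p i - κ • y = (κ * a) • (p l - p j) := by
    have : p l - p i = (κ * a + κ * b) • (p l - p i) := by rw [hk1, one_smul]
    rw [this, hv]
    module
  have hκ0 : 0 ≤ κ := by positivity
  rw [f1, norm_smul, Real.norm_of_nonneg (mul_nonneg hκ0 hb)] at e1
  rw [f2, norm_smul, Real.norm_of_nonneg (mul_nonneg hκ0 ha), norm_sub_rev (p l)] at e2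
  have g1 : p j - p i - y = p j - p v := by rw [hydef]; abel
  have g2 : p l - p i - y = p l - p v := by rw [hydef]; abel
  rw [g1] at e1
  rw [g2] at e2
  have e3 : ‖p j - p l‖ = ℓ * (‖p j - p v‖ + ‖p l - p v‖) / ‖y‖ := by
    calc ‖p j - p l‖ = (κ * a + κ * b) * ‖p j - p l‖ := by rw [hk1, one_mul]
      _ = _ := by rw [add_mul, e1, e2]; ring
  rw [norm_sub_rev (p i), ← hydef, e3]
  field_simp

end Core
end ISim

namespace ISim

open scoped InnerProductSpace

section RelV

variable {V W : Type*} [AddCommGroup V] [Module ℝ V] [AddCommGroup W] [Module ℝ W] {I : Type*}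

lemma relInt_vertex [Finite I] {X : I → V} (hX : Good X) {i v : I} {π : V →ₗ[ℝ] W} (hπ : LinkMap X i π)
    (hv : ∀ s, FF X s → i ∈ s → v ∈ s → s = univ) : RelInt (lk X i π) (π (X v)) := by
  have := Fintype.ofFinite I
  constructor
  · obtain ⟨t, c, h1, h2, h3⟩ := hX.gen' i v
    rw [h3, map_add, map_smul, hπ.zero, smul_zero, zero_add, map_sum]
    refine Submodule.sum_mem _ fun j _ => ?_
    rw [map_smul]
    by_cases hj : j ∈ nb X i
    · exact Submodule.smul_mem _ _ (Submodule.subset_span ⟨⟨j, hj⟩, rfl⟩)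
    · rw [h2 j hj, zero_smul]; exact Submodule.zero_mem _
  · rintro l h1 ⟨j, hj⟩
    have hi : (l.comp π) (X i) = 0 := by simp [hπ.zero]
    have h2 : ∀ k, 0 ≤ (l.comp π) (X k) := hX.gen i (l.comp π) hi (fun j hj => h1 ⟨j, hj⟩)
    refine lt_of_le_of_ne (h2 v) fun h => hj ?_
    have := hv {k | (l.comp π) (X k) = 0} ⟨l.comp π, h2, fun k => Iff.rfl⟩ hi h.symm
    exact (this ▸ mem_univ j.1 : j.1 ∈ {k | (l.comp π) (X k) = 0})

lemma RelInt.smul {X : I → V} {o : V} (h : RelInt X o) {a : ℝ} (ha : 0 < a) : RelInt X (a • o) :=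
  ⟨Submodule.smul_mem _ _ h.mem, fun l h1 h2 => by
    have := h.pos l h1 h2
    rw [map_smul, smul_eq_mul]; positivity⟩

lemma relInt_lk2 [Finite I] {X : I → V} {Y : I → V} (hX : Good X) (h : Same X Y) {i : I}
    {π : V →ₗ[ℝ] W} {o : W} (this : RelInt (lk Y i π) o) : RelInt (lk2 X Y i π) o := by
  constructor
  · rw [h.range_lk2 i]; exact this.mem
  · rintro l hl ⟨j, hj⟩
    exact this.pos l (fun j => hl ⟨j.1, (h.nb i).symm ▸ j.2⟩) ⟨⟨j.1, h.nb i ▸ j.2⟩, hj⟩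

end RelV

section Core

variable {V : Type*} [NormedAddCommGroup V] [InnerProductSpace ℝ V] {I : Type*}

lemma D_eq [Fintype I] {p q : I → V} (hp : Good (hom p)) (hs : Same (hom p) (hom q))
    (hr : rk (hom p) = 3) {D D' : ℝ}
    (h1 : ∀ v i, i ≠ v → ∑ j ∈ nf (hom p) i, ‖p j - p v‖ = D * ‖p i - p v‖)
    (h2 : ∀ v i, i ≠ v → ∑ j ∈ nf (hom p) i, ‖q j - q v‖ = D' * ‖q i - q v‖) : D = D' := by
  classical
  have hne : Nonempty I := by
    by_contra hI
    rw [not_nonempty_iff] at hI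
    rw [rk_empty] at hr
    omega
  obtain ⟨v⟩ := hne
  obtain ⟨w, hw⟩ := hp.nb_nonempty (by omega) v
  have hq := hs.good hp
  have hsym : ∑ i, ∑ j ∈ nf (hom p) i, ‖p i - p v‖ * ‖q j - q v‖ =
      ∑ i, ∑ j ∈ nf (hom p) i, ‖p j - p v‖ * ‖q i - q v‖ := by
    rw [Finset.sum_comm' (t' := Finset.univ) (s' := nf (hom p))]
    intro x y
    simp only [Finset.mem_univ, true_and, and_true, mem_nf]
    exact nb_symm
  have e1 : ∑ i, ∑ j ∈ nf (hom p) i, ‖p i - p v‖ * ‖q j - q v‖ =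
      D' * ∑ i, ‖p i - p v‖ * ‖q i - q v‖ := by
    rw [Finset.mul_sum]
    refine Finset.sum_congr rfl fun i _ => ?_
    rw [← Finset.mul_sum]
    by_cases hi : i = v
    · simp [hi]
    · rw [h2 v i hi]; ring
  have e2 : ∑ i, ∑ j ∈ nf (hom p) i, ‖p j - p v‖ * ‖q i - q v‖ =
      D * ∑ i, ‖p i - p v‖ * ‖q i - q v‖ := by
    rw [Finset.mul_sum]
    refine Finset.sum_congr rfl fun i _ => ?_
    rw [← Finset.sum_mul]
    by_cases hi : i = v
    · simp [hi]
    · rw [h1 v i hi]; ring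
  have hpos : 0 < ∑ i, ‖p i - p v‖ * ‖q i - q v‖ :=
    Finset.sum_pos' (fun i _ => by positivity)
      ⟨w, Finset.mem_univ _, mul_pos (hom_pos hp hw.1) (hom_pos hq hw.1)⟩
  rw [e1, e2] at hsym
  exact (mul_right_cancel₀ hpos.ne' hsym).symm

lemma prop_step [Fintype I] {p q : I → V} (hp : Good (hom p)) (hs : Same (hom p) (hom q))
    (hr : 3 ≤ rk (hom p)) {c c' : V} {r r' : ℝ} (hc : ∀ i, dist (p i) c = r)
    (hc' : ∀ i, dist (q i) c' = r') {ℓ : ℝ} (hℓ : 0 < ℓ)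
    (he : ∀ i, ∀ j ∈ nb (hom p) i, ‖p j - p i‖ = ℓ)
    (he' : ∀ i, ∀ j ∈ nb (hom p) i, ‖q j - q i‖ = ℓ)
    (hface : ∀ s, FF (hom p) s → s ≠ univ → ∀ i ∈ s, ∀ j ∈ s, ‖p i - p j‖ = ‖q i - q j‖)
    {v i : I} (hiv : i ≠ v) (hv : ∀ s, FF (hom p) s → i ∈ s → v ∈ s → s = univ) {G : ℝ} (hG : 0 < G)
    (hle : ∀ k, ‖q k - q v‖ ≤ G * ‖p k - p v‖) (hi : ‖q i - q v‖ = G * ‖p i - p v‖) :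
    ∀ j ∈ nb (hom p) i, ‖q j - q v‖ = G * ‖p j - p v‖ := by
  have hq := hs.good hp
  have hnf : nf (hom q) = nf (hom p) := by
    funext i; ext j; rw [mem_nf, mem_nf, hs.nb i]
  rcases eq_or_lt_of_le hr with hr3 | hr4
  · obtain ⟨D, hD⟩ := rk3_sum hp hr3.symm hc hℓ he
    obtain ⟨D', hD'⟩ := rk3_sum hq (by rw [← hs.rk hp, hr3]) hc' hℓ (fun i j hj => he' i j (by rwa [hs.nb i]))
    rw [hnf] at hD'
    have hDD := D_eq hp hs hr3.symm hD hD'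
    subst hDD
    have h1 : ∑ j ∈ nf (hom p) i, ‖q j - q v‖ = ∑ j ∈ nf (hom p) i, G * ‖p j - p v‖ := by
      rw [hD' v i hiv, hi, ← Finset.mul_sum, hD v i hiv]; ring
    have h2 := (Finset.sum_eq_sum_iff_of_le (fun j _ => hle j)).1 h1
    exact fun j hj => h2 j (mem_nf.2 hj)
  · have hπ := homπ_link p i
    have hπ' := homπ_link q i
    have a1 : ∀ j : nb (hom p) i, lk (hom p) i (homπ (p i)) j = p j - p i := fun j => homπ_hom _ _ _
    have a2 : ∀ j : nb (hom p) i, lk2 (hom p) (hom q) i (homπ (q i)) j = q j - q i :=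
      fun j => homπ_hom _ _ _
    have hy : p v - p i ≠ 0 := sub_ne_zero.2 fun h => hiv (hom_inj hp h).symm
    have hy' : q v - q i ≠ 0 := sub_ne_zero.2 fun h => hiv (hom_inj hq h).symm
    have hyp := norm_pos_iff.2 hy
    have hyp' := norm_pos_iff.2 hy'
    have ho : RelInt (lk (hom p) i (homπ (p i))) ((ℓ ^ 2 / ‖p v - p i‖ ^ 2) • (p v - p i)) := by
      have := relInt_vertex hp hπ hv
      rw [homπ_hom] at this
      exact this.smul (by positivity)
    have ho' : RelInt (lk2 (hom p) (hom q) i (homπ (q i))) ((ℓ ^ 2 / ‖q v - q i‖ ^ 2) • (q v - q i)) := by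
      have := relInt_vertex hq hπ' (fun s h => hv s ((hs s).2 h))
      rw [homπ_hom] at this
      exact relInt_lk2 hp hs (this.smul (by positivity))
    have d1 : ∀ j : nb (hom p) i, ‖lk (hom p) i (homπ (p i)) j -
        (ℓ ^ 2 / ‖p v - p i‖ ^ 2) • (p v - p i)‖ = ℓ * ‖p j - p v‖ / ‖p i - p v‖ := by
      intro j
      rw [a1, inv_dist hℓ (he i j j.2) hy, sub_sub_sub_cancel_right, norm_sub_rev (p v)]
    have d2 : ∀ j : nb (hom p) i, ‖lk2 (hom p) (hom q) i (homπ (q i)) j -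
        (ℓ ^ 2 / ‖q v - q i‖ ^ 2) • (q v - q i)‖ = ℓ * ‖q j - q v‖ / (G * ‖p i - p v‖) := by
      intro j
      rw [a2, inv_dist hℓ (he' i j j.2) hy', sub_sub_sub_cancel_right, norm_sub_rev (q v), hi]
    rw [norm_sub_rev] at hyp
    have key := weuc (hπ.good hp) (hs.lk2_same hp i hπ hπ') (by have := hπ.rk hp; omega)
      ((2 / ℓ ^ 2) • innerₗ V (c - p i)) ((2 / ℓ ^ 2) • innerₗ V (c' - q i)) ?_ (o := _) (o' := _)
      ?_ ?_ ?_ ?_ ho ho' ?_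
    · intro j hj
      have := key ⟨j, hj⟩
      rw [d1, d2] at this
      field_simp at this
      linarith
    · intro j
      rw [a1]
      have := insc hc i j
      rw [he i j j.2] at this
      simp only [LinearMap.smul_apply, innerₗ_apply_apply, smul_eq_mul]
      rw [div_mul_eq_mul_div, this]
      field_simp
    · have := insc hc i v
      rw [map_smul]
      simp only [LinearMap.smul_apply, innerₗ_apply_apply, smul_eq_mul]
      rw [div_mul_eq_mul_div 2, this]
      have := norm_pos_iff.2 hy
      field_simp
    · intro j
      rw [a2]
      have := insc hc' i j
      rw [he' i j j.2] at this
      simp only [LinearMap.smul_apply, innerₗ_apply_apply, smul_eq_mul]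
      rw [div_mul_eq_mul_div, this]
      field_simp
    · have := insc hc' i v
      rw [map_smul]
      simp only [LinearMap.smul_apply, innerₗ_apply_apply, smul_eq_mul]
      rw [div_mul_eq_mul_div 2, this]
      field_simp
    · intro s' hs' hsu a ha b hb
      rw [hπ.face hp] at hs'
      obtain ⟨s, hsf, his, rfl⟩ := hs'
      have hsne : s ≠ univ := by rintro rfl; exact hsu (by simp)
      rw [a1, a1, a2, a2, sub_sub_sub_cancel_right, sub_sub_sub_cancel_right]
      exact hface s hsf hsne a ha b hb
    · intro j
      rw [d1, d2, div_le_div_iff₀ (by positivity) hyp]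
      have h1 := mul_le_mul_of_nonneg_left (hle j) (by positivity : 0 ≤ ℓ * ‖p i - p v‖)
      linarith

lemma core_le [Fintype I] {p q : I → V} (hp : Good (hom p)) (hs : Same (hom p) (hom q))
    (hr : 3 ≤ rk (hom p)) {c c' : V} {r r' : ℝ} (hc : ∀ i, dist (p i) c = r)
    (hc' : ∀ i, dist (q i) c' = r') {ℓ : ℝ}
    (he : ∀ i, ∀ j ∈ nb (hom p) i, ‖p j - p i‖ = ℓ)
    (he' : ∀ i, ∀ j ∈ nb (hom p) i, ‖q j - q i‖ = ℓ)
    (hface : ∀ s, FF (hom p) s → s ≠ univ → ∀ i ∈ s, ∀ j ∈ s, ‖p i - p j‖ = ‖q i - q j‖)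
    (i v : I) : ‖q i - q v‖ ≤ ‖p i - p v‖ := by
  have hq := hs.good hp
  have hℓ : 0 < ℓ := by
    obtain ⟨w, hw⟩ := hp.nb_nonempty (by omega) i
    rw [← he i w hw]
    exact hom_pos hp hw.1
  by_contra hcon
  push Not at hcon
  have hiv : i ≠ v := by rintro rfl; simp at hcon
  obtain ⟨⟨m, hm⟩, hmax⟩ := by
    haveI : Nonempty {i // i ≠ v} := ⟨⟨i, hiv⟩⟩
    exact Finite.exists_max (fun i : {i // i ≠ v} => ‖q i - q v‖ / ‖p i - p v‖)
  set G := ‖q m - q v‖ / ‖p m - p v‖ with hGdef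
  have hG1 : 1 < G := by
    have := hmax ⟨i, hiv⟩
    have h2 : 1 < ‖q i - q v‖ / ‖p i - p v‖ := by rwa [one_lt_div (hom_pos hp hiv)]
    exact h2.trans_le this
  have hle : ∀ k, ‖q k - q v‖ ≤ G * ‖p k - p v‖ := by
    intro k
    by_cases hk : k = v
    · simp [hk]
    · have := hmax ⟨k, hk⟩
      rwa [div_le_iff₀ (hom_pos hp hk)] at this
  have hT := hp.conn {k | k ≠ v ∧ ‖q k - q v‖ = G * ‖p k - p v‖}
    ⟨m, hm, by rw [hGdef]; have := hom_pos hp hm; field_simp⟩ ?_ v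
  · exact hT.1 rfl
  · rintro k ⟨hkv, hk⟩ j hj
    have hv : ∀ s, FF (hom p) s → k ∈ s → v ∈ s → s = univ := by
      intro s h1 h2 h3
      by_contra h4
      have := hface s h1 h4 k h2 v h3
      have h5 := hom_pos hp hkv
      nlinarith
    refine ⟨?_, prop_step hp hs hr hc hc' hℓ he he' hface hkv hv (by linarith) hle hk j hj⟩
    rintro rfl
    have := hv _ hj.2 (by simp) (by simp)
    exact pair_ne_univ (X := hom p) (by omega) k j this

theorem core.{u} : ∀ n : ℕ, ∀ {I : Type u} [Finite I] {p q : I → V} (_ : Nat.card I ≤ n)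
    (_ : Good (hom p)) (_ : Same (hom p) (hom q))
    {c c' : V} {r r' : ℝ} (_ : ∀ i, dist (p i) c = r)
    (_ : ∀ i, dist (q i) c' = r') {ℓ : ℝ}
    (_ : ∀ i, ∀ j ∈ nb (hom p) i, ‖p j - p i‖ = ℓ)
    (_ : ∀ i, ∀ j ∈ nb (hom p) i, ‖q j - q i‖ = ℓ)
    (i j : I), ‖p i - p j‖ = ‖q i - q j‖ := by
  intro n
  induction n with
  | zero =>
    intro I _ p q hn _ _ _ _ _ _ _ _ _ _ _ i
    have : Nonempty I := ⟨i⟩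
    have : 0 < Nat.card I := Nat.card_pos
    omega
  | succ n ih =>
    intro I _ p q hn hp hs c c' r r' hc hc' ℓ he he' i j
    have := Fintype.ofFinite I
    have hq := hs.good hp
    have hface : ∀ s, FF (hom p) s → s ≠ univ → ∀ i ∈ s, ∀ j ∈ s, ‖p i - p j‖ = ‖q i - q j‖ := by
      intro s hsf hsu i hi j hj
      have hcard : Nat.card s < Nat.card I := by
        have := Set.ncard_lt_ncard (ssubset_univ_iff.2 hsu) (toFinite _)
        rwa [Set.ncard_univ] at this
      have hsf' := (hs s).1 hsf
      have hnb : ∀ a b : s, b ∈ nb (hom (fun i : s => p i)) a → (b : I) ∈ nb (hom p) a := by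
        rintro a b ⟨h1, h2⟩
        refine ⟨fun h => h1 (Subtype.ext h), ?_⟩
        have h3 := (hsf.restrict (t := {a, b})).1 h2
        rwa [image_pair] at h3
      refine ih (I := s) (p := fun i => p i) (q := fun i => q i) (by omega) (hp.restrict hsf) ?_
        (fun i => hc i) (fun i => hc' i) (ℓ := ℓ) (fun a b hb => he a b (hnb a b hb))
        (fun a b hb => he' a b (hnb a b hb)) ⟨i, hi⟩ ⟨j, hj⟩
      intro t
      exact (hsf.restrict (t := t)).trans ((hs _).trans (hsf'.restrict (t := t)).symm)
    by_cases hr : 3 ≤ rk (hom p)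
    · apply le_antisymm
      · refine core_le hq hs.symm (by rwa [← hs.rk hp]) hc' hc (ℓ := ℓ)
          (fun i j hj => he' i j (by rwa [hs.nb i])) (fun i j hj => he i j (by rwa [hs.nb i])) ?_ i j
        intro s h1 h2 i hi j hj
        exact (hface s ((hs s).2 h1) h2 i hi j hj).symm
      · exact core_le hp hs hr hc hc' he he' hface i j
    · have hcases : rk (hom p) = 0 ∨ rk (hom p) = 1 ∨ rk (hom p) = 2 := by omega
      rcases hcases with h | h | h
      · exact ((hp.empty_of_rk_zero h).false i).elim
      · rw [hp.rk_one h i j]; simp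
      · obtain ⟨k, h1, h2, h3⟩ := hp.rk_two h i
        rcases h3 j with rfl | rfl
        · simp
        · rw [norm_sub_rev, norm_sub_rev (q i), he i j ⟨h1, h2⟩, he' i j ⟨h1, h2⟩]

end Core
end ISim

namespace ISim

section Faces

variable {V : Type*} [NormedAddCommGroup V] [InnerProductSpace ℝ V]

/-- smallest extreme set through a point -/
def Mx (P : Set V) (x : V) : Set V := ⋂₀ {F | IsExtreme ℝ P F ∧ x ∈ F}

lemma Mx_extreme {P : Set V} {x : V} (hx : x ∈ P) : IsExtreme ℝ P (Mx P x) :=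
  isExtreme_sInter ⟨P, IsExtreme.rfl, hx⟩ fun _ h => h.1

lemma mem_Mx (P : Set V) (x : V) : x ∈ Mx P x := fun _ h => h.2

lemma Mx_subset {P F : Set V} {x : V} (hF : IsExtreme ℝ P F) (hx : x ∈ F) : Mx P x ⊆ F :=
  sInter_subset_of_mem ⟨hF, hx⟩

lemma extreme_union {P : Set V} {ι : Type*} {F : ι → Set V} (h : ∀ i, IsExtreme ℝ P (F i)) :
    IsExtreme ℝ P (⋃ i, F i) := by
  constructor
  · exact iUnion_subset fun i => (h i).1
  · intro x hx y hy z hz hzo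
    obtain ⟨i, hi⟩ := mem_iUnion.1 hz
    exact mem_iUnion.2 ⟨i, (h i).2 hx hy hi hzo⟩

lemma extreme_empty (P : Set V) : IsExtreme ℝ P (∅ : Set V) :=
  ⟨empty_subset _, fun _ _ _ _ _ h => h.elim⟩

lemma phi_Mx {P Q : Set V} (Φ : {F : Set V // IsExtreme ℝ P F} ≃o {F : Set V // IsExtreme ℝ Q F})
    {x : V} (hx : x ∈ P) : ∃ y ∈ Q, (Φ ⟨Mx P x, Mx_extreme hx⟩ : Set V) = Mx Q y := by
  set B := Φ ⟨Mx P x, Mx_extreme hx⟩ with hB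
  have hBQ : ∀ y : ↥B.1, y.1 ∈ Q := fun y => B.2.1 y.2
  let C : ↥B.1 → {F : Set V // IsExtreme ℝ P F} := fun y => Φ.symm ⟨Mx Q y, Mx_extreme (hBQ y)⟩
  let U : {F : Set V // IsExtreme ℝ P F} := ⟨⋃ y, (C y : Set V), extreme_union fun y => (C y).2⟩
  have h1 : B ≤ Φ U := by
    intro y hy
    have : C ⟨y, hy⟩ ≤ U := by
      intro z hz; exact mem_iUnion.2 ⟨⟨y, hy⟩, hz⟩
    have h2 := Φ.monotone this
    simp only [C, OrderIso.apply_symm_apply] at h2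
    exact h2 (mem_Mx Q y)
  have h2 : (⟨Mx P x, Mx_extreme hx⟩ : {F : Set V // IsExtreme ℝ P F}) ≤ U := Φ.le_iff_le.1 h1
  obtain ⟨y, hy⟩ := mem_iUnion.1 (h2 (mem_Mx P x))
  have h3 : (⟨Mx P x, Mx_extreme hx⟩ : {F : Set V // IsExtreme ℝ P F}) ≤ C y := Mx_subset (C y).2 hy
  have h4 := Φ.monotone h3
  simp only [C, OrderIso.apply_symm_apply] at h4
  exact ⟨y, hBQ y, Subset.antisymm h4 (Mx_subset B.2 y.2)⟩

variable {I : Type*}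

lemma mem_hull [Fintype I] {p : I → V} {x : V} (hx : x ∈ convexHull ℝ (range p)) :
    ∃ w : I → ℝ, (∀ i, 0 ≤ w i) ∧ ∑ i, w i = 1 ∧ x = ∑ i, w i • p i := by
  classical
  have : convexHull ℝ (range p) ⊆ (Fintype.linearCombination ℝ p) '' stdSimplex ℝ I := by
    apply convexHull_min
    · rintro _ ⟨i, rfl⟩
      exact ⟨Pi.single i 1, single_mem_stdSimplex ℝ i, by simp [Fintype.linearCombination_apply_single]⟩
    · exact (convex_stdSimplex ℝ I).linear_image _
  obtain ⟨w, hw, rfl⟩ := this hx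
  exact ⟨w, hw.1, hw.2, by simp [Fintype.linearCombination_apply]⟩

lemma hull_mem [Fintype I] {p : I → V} {w : I → ℝ} (h0 : ∀ i, 0 ≤ w i) (h1 : ∑ i, w i = 1) :
    ∑ i, w i • p i ∈ convexHull ℝ (range p) :=
  (convex_convexHull ℝ _).sum_mem (fun i _ => h0 i) h1 fun i _ => subset_convexHull ℝ _ ⟨i, rfl⟩

lemma hom_comb [Fintype I] {p : I → V} {w : I → ℝ} (h1 : ∑ i, w i = 1) :
    ((∑ i, w i • p i, 1) : V × ℝ) = ∑ i, w i • hom p i := by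
  ext
  · simp [hom, Prod.fst_sum]
  · simp [hom, Prod.snd_sum, h1]

lemma hom_nonneg [Fintype I] {p : I → V} {l : V × ℝ →ₗ[ℝ] ℝ} (hl : ∀ i, 0 ≤ l (hom p i)) {x : V}
    (hx : x ∈ convexHull ℝ (range p)) : 0 ≤ l (x, 1) := by
  obtain ⟨w, h0, h1, rfl⟩ := mem_hull hx
  rw [hom_comb h1, map_sum]
  exact Finset.sum_nonneg fun i _ => by rw [map_smul]; exact mul_nonneg (h0 i) (hl i)

lemma extreme_of_fun [Fintype I] {p : I → V} {l : V × ℝ →ₗ[ℝ] ℝ} (hl : ∀ i, 0 ≤ l (hom p i)) :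
    IsExtreme ℝ (convexHull ℝ (range p)) {x | x ∈ convexHull ℝ (range p) ∧ l (x, 1) = 0} := by
  constructor
  · exact fun x hx => hx.1
  · rintro x hx y hy z ⟨hz, hz0⟩ ⟨a, b, ha, hb, hab, rfl⟩
    refine ⟨hx, ?_⟩
    have e : ((a • x + b • y, 1) : V × ℝ) = a • (x, (1 : ℝ)) + b • (y, (1 : ℝ)) := by
      ext
      · simp
      · simp [hab]
    rw [e, map_add, map_smul, map_smul, smul_eq_mul, smul_eq_mul] at hz0
    have h1 := hom_nonneg hl hx
    have h2 := mul_nonneg hb.le (hom_nonneg hl hy)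
    have h3 := mul_nonneg ha.le h1
    have : a * l (x, 1) = 0 := by linarith
    exact (mul_eq_zero.1 this).resolve_left ha.ne'

lemma mem_Mx_iff [Fintype I] {p : I → V} {x : V} (hx : x ∈ convexHull ℝ (range p)) (i : I) :
    p i ∈ Mx (convexHull ℝ (range p)) x ↔
      ∀ l : V × ℝ →ₗ[ℝ] ℝ, (∀ i, 0 ≤ l (hom p i)) → l (x, 1) = 0 → l (hom p i) = 0 := by
  constructor
  · intro h l h1 h2
    exact (Mx_subset (extreme_of_fun h1) ⟨hx, h2⟩ h).2
  · intro h F hF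
    obtain ⟨hF, hxF⟩ := hF
    rcases farkas_line (hom p) (x, 1) (-hom p i) with ⟨c, t, hc, he⟩ | ⟨l, h1, h2, h3⟩
    · have e1 := congrArg Prod.fst he
      have e2 := congrArg Prod.snd he
      simp [hom, Prod.fst_sum, Prod.snd_sum] at e1 e2
      set C := ∑ k, c k
      have hC : 0 ≤ C := Finset.sum_nonneg fun i _ => hc i
      have hpi : p i ∈ convexHull ℝ (range p) := subset_convexHull ℝ _ ⟨i, rfl⟩
      have hx1 : (1 + C) • x = p i + ∑ k, c k • p k := by
        have ht : t = -(1 + C) := by linarith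
        rw [ht, neg_smul] at e1
        have : p i = (1 + C) • x - ∑ k, c k • p k := by rw [← neg_inj, e1]; abel
        rw [this]; abel
      rcases eq_or_lt_of_le hC with h0 | h0
      · have hz : ∀ k, c k = 0 := fun k =>
          (Finset.sum_eq_zero_iff_of_nonneg (fun i _ => hc i)).1 h0.symm k (Finset.mem_univ k)
        simp only [← h0, add_zero, one_smul, hz, zero_smul, Finset.sum_const_zero] at hx1
        rwa [← hx1]
      · have hy : ∑ k, (c k / C) • p k ∈ convexHull ℝ (range p) :=
          hull_mem (fun i => div_nonneg (hc i) hC) (by rw [← Finset.sum_div]; exact div_self h0.ne')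
        refine hF.2 hpi hy hxF ⟨1 / (1 + C), C / (1 + C), by positivity, by positivity, by field_simp, ?_⟩
        have e3 : ∑ k, (c k / C) • p k = C⁻¹ • ∑ k, c k • p k := by
          rw [Finset.smul_sum]
          exact Finset.sum_congr rfl fun k _ => by rw [smul_smul, div_eq_inv_mul]
        have e4 : ∑ k, c k • p k = (1 + C) • x - p i := by rw [hx1]; abel
        rw [e3, e4]
        have : 1 + C ≠ 0 := by positivity
        match_scalars <;> field_simp <;> ring
    · have := h l h1 h2
      rw [map_neg, this] at h3
      simp at h3

/-- vertex index set of the minimal extreme set -/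
def vs (p : I → V) (B : Set V) : Set I := {i | p i ∈ B}

lemma vs_face [Fintype I] {p : I → V} {x : V} (hx : x ∈ convexHull ℝ (range p)) :
    FF (hom p) (vs p (Mx (convexHull ℝ (range p)) x)) ∧
      (vs p (Mx (convexHull ℝ (range p)) x)).Nonempty := by
  classical
  have hch : ∀ i, ∃ l : V × ℝ →ₗ[ℝ] ℝ, (∀ j, 0 ≤ l (hom p j)) ∧ l (x, 1) = 0 ∧
      (p i ∉ Mx (convexHull ℝ (range p)) x → l (hom p i) ≠ 0) := by
    intro i
    by_cases h : p i ∈ Mx (convexHull ℝ (range p)) x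
    · exact ⟨0, by simp, by simp, fun h' => (h' h).elim⟩
    · have h' := h
      rw [mem_Mx_iff hx] at h'
      push Not at h'
      obtain ⟨l, h1, h2, h3⟩ := h'
      exact ⟨l, h1, h2, fun _ => h3⟩
  choose l h1 h2 h3 using hch
  have hs : ∀ y, (∑ i, l i) y = ∑ i, l i y := fun y => by simp [LinearMap.sum_apply]
  have hF : ∀ i, i ∈ vs p (Mx (convexHull ℝ (range p)) x) ↔ (∑ i, l i) (hom p i) = 0 := by
    intro i
    rw [hs, Finset.sum_eq_zero_iff_of_nonneg (fun k _ => h1 k i)]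
    constructor
    · intro hi k _
      exact (mem_Mx_iff hx i).1 hi (l k) (h1 k) (h2 k)
    · intro h
      by_contra hc
      exact h3 i hc (h i (Finset.mem_univ i))
  refine ⟨⟨∑ i, l i, fun i => by rw [hs]; exact Finset.sum_nonneg fun k _ => h1 k i, hF⟩, ?_⟩
  obtain ⟨w, w0, w1, hw⟩ := mem_hull hx
  obtain ⟨i, hi⟩ : ∃ i, w i ≠ 0 := by
    by_contra hcon
    push Not at hcon
    simp [hcon] at w1
  refine ⟨i, (mem_Mx_iff hx i).2 fun m m1 m2 => ?_⟩
  rw [hw, hom_comb w1, map_sum, Finset.sum_eq_zero_iff_of_nonneg (fun k _ => by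
    rw [map_smul]; exact mul_nonneg (w0 k) (m1 k))] at m2
  have := m2 i (Finset.mem_univ i)
  rw [map_smul, smul_eq_mul] at this
  exact (mul_eq_zero.1 this).resolve_left hi

lemma face_vs [Fintype I] {p : I → V} {s : Set I} (hs : FF (hom p) s) (hne : s.Nonempty) :
    ∃ x ∈ convexHull ℝ (range p), s = vs p (Mx (convexHull ℝ (range p)) x) := by
  classical
  obtain ⟨l, h1, h2⟩ := hs
  obtain ⟨i0, hi0⟩ := hne
  set S : Finset I := Finset.univ.filter (· ∈ s) with hS
  have hSc : 0 < (S.card : ℝ) := by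
    have : 0 < S.card := Finset.card_pos.2 ⟨i0, by simp [hS, hi0]⟩
    exact_mod_cast this
  let w : I → ℝ := fun i => if i ∈ s then (S.card : ℝ)⁻¹ else 0
  have w0 : ∀ i, 0 ≤ w i := by intro i; simp only [w]; split_ifs <;> positivity
  have w1 : ∑ i, w i = 1 := by
    simp only [w]
    rw [← Finset.sum_filter, Finset.sum_const, nsmul_eq_mul]
    exact mul_inv_cancel₀ hSc.ne'
  have hx := hull_mem (p := p) w0 w1
  refine ⟨_, hx, ?_⟩
  ext i
  change i ∈ s ↔ p i ∈ Mx (convexHull ℝ (range p)) _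
  rw [mem_Mx_iff hx]
  constructor
  · intro hi m m1 m2
    rw [hom_comb w1, map_sum, Finset.sum_eq_zero_iff_of_nonneg (fun k _ => by
      rw [map_smul]; exact mul_nonneg (w0 k) (m1 k))] at m2
    have := m2 i (Finset.mem_univ i)
    rw [map_smul, smul_eq_mul] at this
    refine (mul_eq_zero.1 this).resolve_left ?_
    simp only [w, hi, if_true]
    positivity
  · intro h
    rw [h2]
    apply h l h1
    rw [hom_comb w1, map_sum]
    refine Finset.sum_eq_zero fun k _ => ?_
    by_cases hk : k ∈ s
    · rw [map_smul, (h2 k).1 hk, smul_zero]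
    · simp [w, hk]

lemma hom_good [Fintype I] {p : I → V} (hinj : Function.Injective p)
    (hext : ∀ i, IsExtreme ℝ (convexHull ℝ (range p)) {p i}) : Good (hom p) := by
  constructor
  · exact ⟨LinearMap.snd ℝ V ℝ, fun i => by simp [hom], fun i => by simp [hom]⟩
  · intro i
    have hx : p i ∈ convexHull ℝ (range p) := subset_convexHull ℝ _ ⟨i, rfl⟩
    have := (vs_face hx).1
    convert this
    ext j
    change j = i ↔ p j ∈ Mx (convexHull ℝ (range p)) (p i)
    constructor
    · rintro rfl; exact mem_Mx _ _
    · intro h; exact hinj (Mx_subset (hext i) rfl h)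

lemma edge_extreme [Fintype I] {p : I → V} {i j : I} (h : FF (hom p) {i, j}) :
    IsExtreme ℝ (convexHull ℝ (range p)) (segment ℝ (p i) (p j)) := by
  classical
  obtain ⟨l, h1, h2⟩ := h
  convert extreme_of_fun h1
  ext y
  constructor
  · intro hy
    refine ⟨(convex_convexHull ℝ _).segment_subset (subset_convexHull ℝ (range p) ⟨i, rfl⟩)
      (subset_convexHull ℝ (range p) ⟨j, rfl⟩) hy, ?_⟩
    obtain ⟨a, b, ha, hb, hab, rfl⟩ := hy
    have e : ((a • p i + b • p j, 1) : V × ℝ) = a • hom p i + b • hom p j := by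
      ext
      · simp [hom]
      · simp [hom, hab]
    rw [e, map_add, map_smul, map_smul, (h2 i).1 (by simp), (h2 j).1 (by simp)]; simp
  · rintro ⟨hy, hy0⟩
    obtain ⟨w, w0, w1, rfl⟩ := mem_hull hy
    rw [hom_comb w1, map_sum, Finset.sum_eq_zero_iff_of_nonneg (fun k _ => by
      rw [map_smul]; exact mul_nonneg (w0 k) (h1 k))] at hy0
    have hz : ∀ k, k ≠ i → k ≠ j → w k = 0 := by
      intro k hi hj
      have := hy0 k (Finset.mem_univ k)
      rw [map_smul, smul_eq_mul] at this
      refine (mul_eq_zero.1 this).resolve_right fun h => ?_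
      have := (h2 k).2 h
      simp [hi, hj] at this
    rw [← convexHull_pair]
    have hz' : ∀ k ∈ Finset.univ, k ∉ Finset.univ.filter (fun k => k = i ∨ k = j) → w k = 0 := by
      intro k _ hk
      simp only [Finset.mem_filter, Finset.mem_univ, true_and, not_or] at hk
      exact hz k hk.1 hk.2
    rw [← Finset.sum_subset (Finset.subset_univ (Finset.univ.filter (fun k => k = i ∨ k = j)))
      (fun k h1 h2 => by rw [hz' k h1 h2, zero_smul])]
    refine (convex_convexHull ℝ _).sum_mem (fun k _ => w0 k) ?_ ?_
    · rw [Finset.sum_subset (Finset.subset_univ _) hz', w1]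
    · intro k hk
      apply subset_convexHull
      simp only [Finset.mem_filter, Finset.mem_univ, true_and] at hk
      rcases hk with rfl | rfl <;> simp

end Faces
end ISim

namespace ISim

section Comb

variable {V : Type*} [NormedAddCommGroup V] [InnerProductSpace ℝ V]
variable {I J : Type*}

lemma phi_vertex [Fintype J] {P : Set V} {q : J → V}
    (Φ : {F : Set V // IsExtreme ℝ P F} ≃o {F : Set V // IsExtreme ℝ (convexHull ℝ (range q)) F})
    (hq : ∀ k, IsExtreme ℝ (convexHull ℝ (range q)) {q k}) {x : V} (hx : IsExtreme ℝ P {x}) :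
    ∃ k, Φ ⟨{x}, hx⟩ = ⟨{q k}, hq k⟩ := by
  have hne : (Φ ⟨{x}, hx⟩ : Set V).Nonempty := by
    by_contra h
    rw [not_nonempty_iff_eq_empty] at h
    have h1 : Φ ⟨{x}, hx⟩ ≤ Φ ⟨∅, extreme_empty P⟩ := by
      intro y hy
      rw [h] at hy
      exact hy.elim
    have h2 := Φ.le_iff_le.1 h1
    exact h2 (mem_singleton x)
  obtain ⟨y, hy⟩ := hne
  have hyQ := (Φ ⟨{x}, hx⟩).2.1 hy
  obtain ⟨k, hk⟩ := (vs_face hyQ).2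
  have hk1 : q k ∈ (Φ ⟨{x}, hx⟩ : Set V) := Mx_subset (Φ ⟨{x}, hx⟩).2 hy hk
  refine ⟨k, le_antisymm ?_ ?_⟩
  · have h1 : (⟨{q k}, hq k⟩ : {F : Set V // IsExtreme ℝ (convexHull ℝ (range q)) F})
        ≤ Φ ⟨{x}, hx⟩ := fun z hz => by rw [mem_singleton_iff.1 hz]; exact hk1
    have h2 : Φ.symm ⟨{q k}, hq k⟩ ≤ ⟨{x}, hx⟩ := by
      rw [OrderIso.symm_apply_le]; exact h1
    rw [← OrderIso.le_symm_apply]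
    intro z hz
    rw [mem_singleton_iff.1 hz]
    by_contra hc
    have h3 : Φ.symm ⟨{q k}, hq k⟩ ≤ ⟨∅, extreme_empty P⟩ := by
      intro u hu
      have := h2 hu
      rw [mem_singleton_iff.1 this] at hu
      exact (hc hu).elim
    rw [OrderIso.symm_apply_le] at h3
    have h4 : Φ ⟨∅, extreme_empty P⟩ ≤ ⟨∅, extreme_empty _⟩ := by
      rw [← OrderIso.le_symm_apply]; exact fun u hu => hu.elim
    exact h4 (h3 (mem_singleton (q k)))
  · intro z hz
    rw [mem_singleton_iff.1 hz]; exact hk1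

lemma same_half [Fintype I] [Fintype J] {p : I → V} {q : J → V}
    (Φ : {F : Set V // IsExtreme ℝ (convexHull ℝ (range p)) F} ≃o
      {F : Set V // IsExtreme ℝ (convexHull ℝ (range q)) F})
    (hp : ∀ k, IsExtreme ℝ (convexHull ℝ (range p)) {p k})
    (hq : ∀ k, IsExtreme ℝ (convexHull ℝ (range q)) {q k}) (σ : I → J)
    (hσ : ∀ i, Φ ⟨{p i}, hp i⟩ = ⟨{q (σ i)}, hq (σ i)⟩) {s : Set I} (hs : FF (hom p) s)
    (hne : s.Nonempty) : ∃ t, FF (hom q) t ∧ ∀ i, i ∈ s ↔ σ i ∈ t := by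
  obtain ⟨x, hx, rfl⟩ := face_vs hs hne
  obtain ⟨y, hy, hxy⟩ := phi_Mx Φ hx
  refine ⟨vs q (Mx _ y), (vs_face hy).1, fun i => ?_⟩
  have h1 : p i ∈ Mx (convexHull ℝ (range p)) x ↔
      (⟨{p i}, hp i⟩ : {F : Set V // IsExtreme ℝ (convexHull ℝ (range p)) F})
        ≤ ⟨Mx (convexHull ℝ (range p)) x, Mx_extreme hx⟩ := by
    change _ ↔ ({p i} : Set V) ⊆ Mx (convexHull ℝ (range p)) x
    rw [singleton_subset_iff]
  have h2 : q (σ i) ∈ Mx (convexHull ℝ (range q)) y ↔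
      (⟨{q (σ i)}, hq (σ i)⟩ : {F : Set V // IsExtreme ℝ (convexHull ℝ (range q)) F})
        ≤ Φ ⟨Mx (convexHull ℝ (range p)) x, Mx_extreme hx⟩ := by
    change _ ↔ ({q (σ i)} : Set V) ⊆ (Φ ⟨Mx (convexHull ℝ (range p)) x, Mx_extreme hx⟩ : Set V)
    rw [singleton_subset_iff, hxy]
  change p i ∈ Mx (convexHull ℝ (range p)) x ↔ q (σ i) ∈ Mx (convexHull ℝ (range q)) y
  rw [h1, h2, ← hσ, Φ.le_iff_le]

lemma FF_equiv {q : J → V} (σ : I ≃ J) {t : Set J} (ht : FF (hom q) t) :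
    FF (hom (q ∘ σ)) (σ ⁻¹' t) := by
  obtain ⟨l, h1, h2⟩ := ht
  exact ⟨l, fun i => h1 (σ i), fun i => h2 (σ i)⟩

lemma exists_equiv [Fintype I] [Fintype J] {p : I → V} {q : J → V}
    (Φ : {F : Set V // IsExtreme ℝ (convexHull ℝ (range p)) F} ≃o
      {F : Set V // IsExtreme ℝ (convexHull ℝ (range q)) F})
    (hpi : Function.Injective p) (hqi : Function.Injective q)
    (hp : ∀ k, IsExtreme ℝ (convexHull ℝ (range p)) {p k})
    (hq : ∀ k, IsExtreme ℝ (convexHull ℝ (range q)) {q k}) :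
    ∃ σ : I ≃ J, Same (hom p) (hom (q ∘ σ)) := by
  choose σ hσ using fun i => phi_vertex Φ hq (hp i)
  choose τ hτ using fun i => phi_vertex Φ.symm hp (hq i)
  have hτσ : ∀ i, τ (σ i) = i := by
    intro i
    have := hτ (σ i)
    rw [← hσ, OrderIso.symm_apply_apply] at this
    have h2 : ({p i} : Set V) = {p (τ (σ i))} := congrArg Subtype.val this
    exact (hpi (singleton_eq_singleton_iff.1 h2)).symm
  have hστ : ∀ i, σ (τ i) = i := by
    intro i
    have := hσ (τ i)
    rw [← hτ, OrderIso.apply_symm_apply] at this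
    have h2 : ({q i} : Set V) = {q (σ (τ i))} := congrArg Subtype.val this
    exact (hqi (singleton_eq_singleton_iff.1 h2)).symm
  let e : I ≃ J := ⟨σ, τ, hτσ, hστ⟩
  have gp := hom_good hpi hp
  have gq := hom_good hqi hq
  refine ⟨e, fun s => ?_⟩
  rcases s.eq_empty_or_nonempty with rfl | hne
  · exact ⟨fun _ => FF_equiv e gq.empty, fun _ => gp.empty⟩
  constructor
  · intro hs
    obtain ⟨t, ht, h⟩ := same_half Φ hp hq σ hσ hs hne
    have : s = e ⁻¹' t := by ext i; exact h i
    rw [this]; exact FF_equiv e ht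
  · intro hs
    have h1 := FF_equiv e.symm hs
    have h2 : (q ∘ e) ∘ e.symm = q := by ext1 j; simp
    rw [h2] at h1
    obtain ⟨t, ht, h⟩ := same_half Φ.symm hq hp τ hτ h1 (by
      obtain ⟨i, hi⟩ := hne
      exact ⟨e i, by simpa using hi⟩)
    have : s = t := by
      ext i
      have := h (σ i)
      rw [hτσ] at this
      rw [← this]
      change i ∈ s ↔ τ (σ i) ∈ s
      rw [hτσ]
    rw [this]; exact ht

lemma hom_scale {q : I → V} {a : ℝ} (ha : a ≠ 0) {s : Set I} :
    FF (hom (fun i => a • q i)) s ↔ FF (hom q) s := by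
  have := FF.map (X := hom q) (s := s) ((a • LinearMap.id : V →ₗ[ℝ] V).prodMap
    (LinearMap.id : ℝ →ₗ[ℝ] ℝ)) (by
      rintro ⟨x, t⟩ ⟨y, u⟩ h
      simp only [LinearMap.prodMap_apply, LinearMap.smul_apply, LinearMap.id_apply,
        Prod.mk.injEq] at h
      rw [smul_right_injective V ha h.1, h.2])
  rw [← this]
  rfl

end Comb

section Final

variable {V : Type*} [NormedAddCommGroup V] [InnerProductSpace ℝ V] [FiniteDimensional ℝ V]
variable {I : Type*}

/-- Gram equality gives a linear isometry -/
lemma gram_isometry (u v : I → V) (h : ∀ i j, inner ℝ (u i) (u j) = inner ℝ (v i) (v j)) :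
    ∃ L : V →ₗᵢ[ℝ] V, ∀ i, L (u i) = v i := by
  classical
  have hn : ∀ c : I →₀ ℝ, ‖Finsupp.linearCombination ℝ v c‖ = ‖Finsupp.linearCombination ℝ u c‖ := by
    intro c
    rw [← sq_eq_sq₀ (norm_nonneg _) (norm_nonneg _), ← real_inner_self_eq_norm_sq,
      ← real_inner_self_eq_norm_sq]
    simp only [Finsupp.linearCombination_apply, Finsupp.sum, sum_inner, inner_sum,
      real_inner_smul_left, real_inner_smul_right, h]
  let U := Finsupp.linearCombination ℝ u
  obtain ⟨g, hg⟩ := LinearMap.exists_rightInverse_of_surjective U.rangeRestrict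
    (LinearMap.range_rangeRestrict U)
  have hg' : ∀ x : LinearMap.range U, U (g x) = x := fun x => by
    have := LinearMap.congr_fun hg x
    exact congrArg Subtype.val this
  let L0 : LinearMap.range U →ₗᵢ[ℝ] V :=
    { toLinearMap := (Finsupp.linearCombination ℝ v).comp g
      norm_map' := fun x => by
        change ‖Finsupp.linearCombination ℝ v (g x)‖ = ‖x‖
        rw [hn]
        change ‖U (g x)‖ = ‖x‖
        rw [hg']; rfl }
  refine ⟨L0.extend, fun i => ?_⟩
  have hi : u i ∈ LinearMap.range U := ⟨Finsupp.single i 1, by simp [U]⟩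
  have h1 := L0.extend_apply ⟨u i, hi⟩
  change L0.extend (u i) = _ at h1
  rw [h1]
  change Finsupp.linearCombination ℝ v (g ⟨u i, hi⟩) = v i
  have h2 := hn (g ⟨u i, hi⟩ - Finsupp.single i 1)
  have h3 : Finsupp.linearCombination ℝ u (g ⟨u i, hi⟩) = u i := hg' ⟨u i, hi⟩
  simp only [map_sub, h3] at h2
  simp only [Finsupp.linearCombination_single, one_smul, sub_self, norm_zero, norm_eq_zero] at h2
  exact sub_eq_zero.1 h2

lemma similar_of_dist [Nonempty I] {p q : I → V} {r : ℝ} (hr : 0 < r)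
    (h : ∀ i j, ‖q i - q j‖ = r * ‖p i - p j‖) :
    ∃ f : V → V, (∀ x y, dist (f x) (f y) = r * dist x y) ∧
      f '' (convexHull ℝ (range p)) = convexHull ℝ (range q) := by
  obtain ⟨o⟩ := ‹Nonempty I›
  obtain ⟨L, hL⟩ := gram_isometry (fun i => p i - p o) (fun i => r⁻¹ • (q i - q o)) (by
    intro i j
    rw [real_inner_smul_left, real_inner_smul_right,
      real_inner_eq_norm_mul_self_add_norm_mul_self_sub_norm_sub_mul_self_div_two,
      real_inner_eq_norm_mul_self_add_norm_mul_self_sub_norm_sub_mul_self_div_two]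
    simp only [sub_sub_sub_cancel_right, h]
    field_simp)
  let A : V →ᵃ[ℝ] V :=
    (AffineMap.const ℝ V (q o)) + (r • L.toLinearMap).toAffineMap.comp
      (AffineMap.id ℝ V - AffineMap.const ℝ V (p o))
  have hA : ∀ x, A x = q o + r • L (x - p o) := fun x => by simp [A]
  refine ⟨A, ?_, ?_⟩
  · intro x y
    rw [hA, hA, dist_add_left, dist_smul₀, L.dist_map, dist_sub_right, Real.norm_of_nonneg hr.le]
  · rw [AffineMap.image_convexHull, ← range_comp]
    congr 2
    ext1 i
    simp only [Function.comp, hA]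
    have := hL i
    rw [this, smul_smul, mul_inv_cancel₀ hr.ne', one_smul]; abel

theorem similar_families [Fintype I] [Nonempty I] {p q : I → V} (hp : Good (hom p))
    (hs : Same (hom p) (hom q)) {c c' : V} {r r' : ℝ} (hc : ∀ i, dist (p i) c = r)
    (hc' : ∀ i, dist (q i) c' = r') {ℓ₁ ℓ₂ : ℝ}
    (h1 : ∀ i, ∀ j ∈ nb (hom p) i, ‖p j - p i‖ = ℓ₁)
    (h2 : ∀ i, ∀ j ∈ nb (hom p) i, ‖q j - q i‖ = ℓ₂) :
    ∃ r : ℝ, 0 < r ∧ ∀ i j, ‖q i - q j‖ = r * ‖p i - p j‖ := by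
  have hq : Good (hom q) := hs.good hp
  have hrk : rk (hom p) = 0 ∨ rk (hom p) = 1 ∨ 2 ≤ rk (hom p) := by omega
  rcases hrk with h | h | h
  · have := hp.empty_of_rk_zero h
    exact (IsEmpty.false (Classical.arbitrary I)).elim
  · refine ⟨1, one_pos, fun i j => ?_⟩
    rw [hp.rk_one h i j]; simp
  · obtain ⟨j, hj⟩ := hp.nb_nonempty h (Classical.arbitrary I)
    have l1 : 0 < ℓ₁ := by rw [← h1 _ j hj]; exact hom_pos hp hj.1
    have l2 : 0 < ℓ₂ := by rw [← h2 _ j hj]; exact hom_pos hq hj.1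
    have ha : 0 < ℓ₁ / ℓ₂ := div_pos l1 l2
    have key := core (Nat.card I) (p := p) (q := fun i => (ℓ₁ / ℓ₂) • q i) le_rfl hp
      (fun s => (hs s).trans (hom_scale ha.ne').symm) (c' := (ℓ₁ / ℓ₂) • c')
      (r' := ℓ₁ / ℓ₂ * r') hc
      (fun i => by rw [dist_smul₀, hc', Real.norm_of_nonneg ha.le]) h1
      (fun i j hj => by
        rw [← smul_sub, norm_smul, h2 i j hj, Real.norm_of_nonneg ha.le]
        field_simp)
    refine ⟨ℓ₂ / ℓ₁, div_pos l2 l1, fun i j => ?_⟩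
    rw [key i j, ← smul_sub, norm_smul, Real.norm_of_nonneg ha.le]
    field_simp

lemma hull_ext {S P : Set V} (hS : S.Finite) (hP : P = convexHull ℝ S) :
    (extremePoints ℝ P).Finite ∧ convexHull ℝ (extremePoints ℝ P) = P := by
  subst hP
  have hf : (extremePoints ℝ (convexHull ℝ S)).Finite := hS.subset extremePoints_convexHull_subset
  refine ⟨hf, ?_⟩
  have := closure_convexHull_extremePoints (hS.isCompact_convexHull ℝ) (convex_convexHull ℝ S)
  rwa [(hf.isClosed_convexHull ℝ).closure_eq] at this

theorem main_aux {S₁ S₂ P₁ P₂ : Set V} (hf₁ : S₁.Finite) (hf₂ : S₂.Finite) (hne : S₁.Nonempty)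
    (hP₁ : P₁ = convexHull ℝ S₁) (hP₂ : P₂ = convexHull ℝ S₂)
    (Φ : {F : Set V // IsExtreme ℝ P₁ F} ≃o {F : Set V // IsExtreme ℝ P₂ F})
    (hins₁ : ∃ (c : V) (r : ℝ), ∀ v ∈ extremePoints ℝ P₁, dist v c = r)
    (hins₂ : ∃ (c : V) (r : ℝ), ∀ v ∈ extremePoints ℝ P₂, dist v c = r)
    (ℓ₁ ℓ₂ : ℝ)
    (hedge₁ : ∀ u v : V, u ≠ v → IsExtreme ℝ P₁ (segment ℝ u v) → dist u v = ℓ₁)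
    (hedge₂ : ∀ u v : V, u ≠ v → IsExtreme ℝ P₂ (segment ℝ u v) → dist u v = ℓ₂) :
    ∃ r : ℝ, 0 < r ∧ ∃ f : V → V,
      (∀ x y, dist (f x) (f y) = r * dist x y) ∧ f '' P₁ = P₂ := by
  obtain ⟨e1, e2⟩ := hull_ext hf₁ hP₁
  obtain ⟨g1, g2⟩ := hull_ext hf₂ hP₂
  have hPne : P₁.Nonempty := by rw [hP₁]; exact hne.convexHull
  clear hP₁ hP₂
  have := e1.fintype
  have := g1.fintype
  obtain ⟨p, hpd⟩ : ∃ p : extremePoints ℝ P₁ → V, p = Subtype.val := ⟨_, rfl⟩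
  obtain ⟨q, hqd⟩ : ∃ q : extremePoints ℝ P₂ → V, q = Subtype.val := ⟨_, rfl⟩
  have hp1 : convexHull ℝ (range p) = P₁ := by rw [hpd, Subtype.range_coe]; exact e2
  have hq1 : convexHull ℝ (range q) = P₂ := by rw [hqd, Subtype.range_coe]; exact g2
  have hpi : Function.Injective p := by rw [hpd]; exact Subtype.val_injective
  have hqi : Function.Injective q := by rw [hqd]; exact Subtype.val_injective
  have hpe : ∀ k, IsExtreme ℝ (convexHull ℝ (range p)) {p k} := by
    intro k; rw [hp1, hpd, isExtreme_singleton]; exact k.2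
  have hqe : ∀ k, IsExtreme ℝ (convexHull ℝ (range q)) {q k} := by
    intro k; rw [hq1, hqd, isExtreme_singleton]; exact k.2
  have : Nonempty (extremePoints ℝ P₁) := by
    rw [nonempty_coe_sort, ← convexHull_nonempty_iff (𝕜 := ℝ), e2]; exact hPne
  obtain ⟨c, r, hc⟩ := hins₁
  obtain ⟨c', r', hc'⟩ := hins₂
  have hcp : ∀ i, dist (p i) c = r := fun i => by rw [hpd]; exact hc _ i.2
  have hcq : ∀ i, dist (q i) c' = r' := fun i => by rw [hqd]; exact hc' _ i.2
  obtain ⟨σ, hσ⟩ : ∃ σ : extremePoints ℝ P₁ ≃ extremePoints ℝ P₂,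
      Same (hom p) (hom (q ∘ σ)) := by
    refine exists_equiv ?_ hpi hqi hpe hqe
    rw [hp1, hq1]; exact Φ
  have hgp := hom_good hpi hpe
  have hrq : range (q ∘ σ) = range q := σ.surjective.range_comp q
  obtain ⟨ρ, hρ, hd⟩ := similar_families hgp hσ hcp (fun i => hcq (σ i)) (ℓ₁ := ℓ₁) (ℓ₂ := ℓ₂)
    (fun i j hj => by
      rw [← dist_eq_norm, dist_comm]
      apply hedge₁
      · exact fun h => hj.1 (hpi h).symm
      · rw [← hp1]; exact edge_extreme hj.2)
    (fun i j hj => by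
      rw [hσ.nb] at hj
      rw [← dist_eq_norm, dist_comm]
      apply hedge₂
      · exact fun h => hj.1 (σ.injective (hqi h)).symm
      · have := edge_extreme hj.2
        rwa [hrq, hq1] at this)
  refine ⟨ρ, hρ, ?_⟩
  obtain ⟨f, hf, hf2⟩ := similar_of_dist hρ hd
  refine ⟨f, hf, ?_⟩
  rw [hp1, hrq, hq1] at hf2
  exact hf2

end Final
end ISim

/-- Two combinatorially equivalent polytopes in `ℝ^d` (`d ≥ 2`), each inscribed
in a sphere and each with all edges of a common length, are similar: one is
obtained from the other by a similarity transformation (a scaling composed with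
an isometry). Here "combinatorially equivalent" means that the lattices of
faces (extreme subsets), ordered by inclusion, are order-isomorphic, vertices
are the extreme points, and edges are the extreme segments. -/
theorem inscribed_equilateral_comb_equiv_implies_similar
    (d : ℕ) (hd : 2 ≤ d)
    (V₁ V₂ : Set (EuclideanSpace ℝ (Fin d)))
    (hV₁fin : V₁.Finite) (hV₂fin : V₂.Finite)
    (hV₁ne : V₁.Nonempty) (hV₂ne : V₂.Nonempty)
    (P₁ P₂ : Set (EuclideanSpace ℝ (Fin d)))
    (hP₁ : P₁ = convexHull ℝ V₁) (hP₂ : P₂ = convexHull ℝ V₂)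
    -- combinatorial equivalence: order isomorphism of the face lattices
    (hcomb : Nonempty
      ({F : Set (EuclideanSpace ℝ (Fin d)) // IsExtreme ℝ P₁ F} ≃o
       {F : Set (EuclideanSpace ℝ (Fin d)) // IsExtreme ℝ P₂ F}))
    -- each polytope is inscribed in a sphere
    (hins₁ : ∃ (c : EuclideanSpace ℝ (Fin d)) (r : ℝ),
        ∀ v ∈ Set.extremePoints ℝ P₁, dist v c = r)
    (hins₂ : ∃ (c : EuclideanSpace ℝ (Fin d)) (r : ℝ),
        ∀ v ∈ Set.extremePoints ℝ P₂, dist v c = r)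
    -- all edges of a common length
    (ℓ₁ ℓ₂ : ℝ)
    (hedge₁ : ∀ u v : EuclideanSpace ℝ (Fin d), u ≠ v →
        IsExtreme ℝ P₁ (segment ℝ u v) → dist u v = ℓ₁)
    (hedge₂ : ∀ u v : EuclideanSpace ℝ (Fin d), u ≠ v →
        IsExtreme ℝ P₂ (segment ℝ u v) → dist u v = ℓ₂) :
    ∃ r : ℝ, 0 < r ∧ ∃ f : EuclideanSpace ℝ (Fin d) → EuclideanSpace ℝ (Fin d),
      (∀ x y, dist (f x) (f y) = r * dist x y) ∧ f '' P₁ = P₂ := by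
  obtain ⟨Φ⟩ := hcomb
  exact ISim.main_aux hV₁fin hV₂fin hV₁ne hP₁ hP₂ Φ hins₁ hins₂ ℓ₁ ℓ₂ hedge₁ hedge₂
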